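/- arXiv:1607.03961 — 12 statements merged into one kernel-verified Lean document; each statement's English description precedes it below -/
import Mathlib

section
/- Let d ≥ 2 and let P be a d-dimensional pattern of side length k over the binary alphabet {0,1} with k ≥ 3·2^d. If P is not almost homogeneous, then P is removable over {0,1}. -/
/-- `A`, a `d`-dimensional array of side length `n`, contains a copy of the
`d`-dimensional pattern `P` of side length `k` starting at `x`. -/
def HasCopy {Γ : Type*} (d n k : ℕ) (A P : (Fin d → ℕ) → Γ) (x : Fin d → ℕ) : Prop :=
  (∀ i, x i + k ≤ n) ∧ ∀ y : Fin d → ℕ, (∀ i, y i < k) → A (fun i => x i + y i) = P y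

/-- The `d`-dimensional pattern `P` of side length `k` is removable over `Γ`. -/
def Removable {Γ : Type*} [DecidableEq Γ] (d k : ℕ) (P : (Fin d → ℕ) → Γ) : Prop :=
  ∀ (n : ℕ) (A : (Fin d → ℕ) → Γ) (x : Fin d → ℕ), HasCopy d n k A P x →
    ∃ (y : Fin d → ℕ) (σ : Γ), (∀ i, y i < k) ∧ σ ≠ A (fun i => x i + y i) ∧
      ∀ x' : Fin d → ℕ,
        HasCopy d n k (Function.update A (fun i => x i + y i) σ) P x' →
        HasCopy d n k A P x'

/-- The `d`-dimensional pattern `P` of side length `k` is almost homogeneous: all its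
entries but one are equal to some `a`, and the differing entry, of value `b ≠ a`,
lies at a corner. -/
def AlmostHomogeneous {Γ : Type*} (d k : ℕ) (P : (Fin d → ℕ) → Γ) : Prop :=
  ∃ (c : Fin d → ℕ) (a b : Γ), (∀ i, c i = 0 ∨ c i = k - 1) ∧ a ≠ b ∧ P c = b ∧
    ∀ y : Fin d → ℕ, (∀ i, y i < k) → y ≠ c → P y = a

/-- The box `[k]^d`, viewed inside `ℤ^d`. -/
def InBox {d : ℕ} (k : ℤ) (z : Fin d → ℤ) : Prop := ∀ i, 0 ≤ z i ∧ z i < k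

/-- A non-removable binary pattern `Q` on the box of side `k` comes with a map `p`: flipping
the entry at `y` in some array creates a new copy of `Q`, shifted by `y - p y`, in which the
flipped entry has index `p y`. The fields record how these copies agree with the original
one and with each other. -/
structure FlipSystem {d : ℕ} (k : ℤ) (Q : (Fin d → ℤ) → Bool)
    (p : (Fin d → ℤ) → (Fin d → ℤ)) : Prop where
  mem : ∀ y, InBox k y → InBox k (p y)
  ne : ∀ y, InBox k y → Q (p y) ≠ Q y
  eq_shift : ∀ y w, InBox k y → InBox k w → InBox k (w + (y - p y)) → w ≠ p y →
    Q w = Q (w + (y - p y))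
  eq_of_shift_eq : ∀ y y' w w', InBox k y → InBox k y' → InBox k w → InBox k w' →
    w + (y - p y) = w' + (y' - p y') → w ≠ p y → w' ≠ p y' → Q w = Q w'
  ne_of_shift_eq : ∀ y y' w', InBox k y → InBox k y' → InBox k w' →
    y = w' + (y' - p y') → w' ≠ p y' → Q (p y) ≠ Q w'

/-- Outside of `M`, the pattern `Q` is periodic with period `u` on the box of side `k`. -/
def PeriodicOff {d : ℕ} (k : ℤ) (Q : (Fin d → ℤ) → Bool) (u : Fin d → ℤ)
    (M : Set (Fin d → ℤ)) : Prop :=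
  ∀ w, InBox k w → InBox k (w + u) → w ∉ M → Q w = Q (w + u)

theorem InBox.add_single {d : ℕ} {k t : ℤ} {z : Fin d → ℤ} {i : Fin d} (hz : InBox k z)
    (h0 : 0 ≤ z i + t) (h1 : z i + t < k) : InBox k (z + Pi.single i t) := by
  intro l
  rcases eq_or_ne l i with rfl | hl
  · simpa using ⟨h0, h1⟩
  · simpa [hl] using hz l

theorem InBox.sub_single {d : ℕ} {k t : ℤ} {z : Fin d → ℤ} {i : Fin d} (hz : InBox k z)
    (h0 : 0 ≤ z i - t) (h1 : z i - t < k) : InBox k (z - Pi.single i t) := by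
  intro l
  rcases eq_or_ne l i with rfl | hl
  · exact ⟨by simpa using h0, by simpa using h1⟩
  · simpa [hl] using hz l

theorem inBox_zero {d : ℕ} {k : ℤ} (hk : 0 < k) : InBox k (0 : Fin d → ℤ) :=
  fun _ => ⟨le_rfl, hk⟩

namespace FlipSystem

variable {d : ℕ} {k : ℤ} {Q : (Fin d → ℤ) → Bool} {p : (Fin d → ℤ) → (Fin d → ℤ)}

theorem shift_injective (h : FlipSystem k Q p) {y y' : Fin d → ℤ} (hy : InBox k y)
    (hy' : InBox k y') (he : y - p y = y' - p y') : y = y' := by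
  by_cases hp : p y' = p y
  · rw [hp] at he
    exact sub_left_injective he
  · have hs : p y' + (y - p y) = y' := by rw [he]; abel
    have := h.eq_shift y (p y') hy (h.mem _ hy') (by rwa [hs]) hp
    rw [hs] at this
    exact absurd this (h.ne _ hy')

theorem periodicOff_of_shift (h : FlipSystem k Q p) {y y' u : Fin d → ℤ} (hy : InBox k y)
    (hy' : InBox k y') (hu : u = (y - p y) - (y' - p y')) :
    PeriodicOff k Q u {p y, p y' - u} := by
  intro w hw hwu hM
  simp only [Set.mem_insert_iff, Set.mem_singleton_iff, not_or] at hM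
  refine h.eq_of_shift_eq y y' w (w + u) hy hy' hw hwu ?_ hM.1 ?_
  · rw [hu]; abel
  · intro e
    exact hM.2 (by rw [← e]; abel)

/-- If `Q` has an axis-parallel period off `M`, then the new copy created by flipping a point
away from `M` has its flipped entry next to `M`. -/
theorem mem_of_periodicOff (h : FlipSystem k Q p) {t : ℤ} {i : Fin d}
    {M : Set (Fin d → ℤ)} (hM : PeriodicOff k Q (Pi.single i t) M) (ht : 0 < t)
    {y : Fin d → ℤ} (hy : InBox k y) (h0 : t ≤ y i) (h1 : y i < k - t)
    (hy1 : y ∉ M) (hy2 : y - Pi.single i t ∉ M) :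
    p y ∈ M ∨ p y - Pi.single i t ∈ M := by
  by_contra hc
  rw [not_or] at hc
  have hp := h.mem y hy
  have hpi := hp i
  set u : Fin d → ℤ := Pi.single i t with hu
  have hu0 : u ≠ 0 := by
    intro e
    have := congrFun e i
    simp [hu] at this
    omega
  rcases lt_or_ge (p y i) (k - t) with hlt | hge
  · have hpu : InBox k (p y + u) := hp.add_single (by omega) (by omega)
    have hyu : InBox k (y + u) := hy.add_single (by omega) (by omega)
    have e : p y + u + (y - p y) = y + u := by abel
    have h3 := h.eq_shift y (p y + u) hy hpu (by rwa [e]) (by simpa using hu0)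
    rw [e] at h3
    exact h.ne y hy (by rw [hM _ hp hpu hc.1, h3, ← hM _ hy hyu hy1])
  · have hpu : InBox k (p y - u) := hp.sub_single (by omega) (by omega)
    have hyu : InBox k (y - u) := hy.sub_single (by omega) (by omega)
    have e : p y - u + (y - p y) = y - u := by abel
    have h3 := h.eq_shift y (p y - u) hy hpu (by rwa [e]) (by simpa using hu0)
    rw [e] at h3
    have h4 := hM _ hpu (by simpa using hp) hc.2
    have h5 := hM _ hyu (by simpa using hy) hy2
    simp only [sub_add_cancel] at h4 h5
    exact h.ne y hy (by rw [← h4, h3, h5])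

/-- If the flipped entries of the points on a segment take few values, then `Q` has a short
period off a single point. -/
theorem exists_periodicOff (h : FlipSystem k Q p) {N : ℕ} {i : Fin d} {z : Fin d → ℤ}
    {S : Finset (Fin d → ℤ)} (hS : S.card ≤ N)
    (hz : ∀ s : ℤ, 0 ≤ s → s ≤ N → InBox k (z + Pi.single i s) ∧ p (z + Pi.single i s) ∈ S) :
    ∃ (j : ℤ) (a : Fin d → ℤ), 0 < j ∧ j ≤ N ∧
      PeriodicOff k Q (Pi.single i j) {a, a - Pi.single i j} := by
  obtain ⟨s, hs, s', hs', hne, he⟩ := Finset.exists_ne_map_eq_of_card_lt_of_maps_to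
    (s := Finset.Icc (0 : ℤ) N) (t := S) (f := fun s => p (z + Pi.single i s))
    (by simp; omega) (by
      intro s hs
      simp only [Finset.coe_Icc, Set.mem_Icc] at hs
      exact (hz s hs.1 hs.2).2)
  wlog hlt : s < s' generalizing s s'
  · exact this s' hs' s hs hne.symm he.symm (by omega)
  simp only [Finset.mem_Icc] at hs hs'
  refine ⟨s' - s, p (z + Pi.single i s'), by omega, by omega, ?_⟩
  have := h.periodicOff_of_shift (u := Pi.single i (s' - s)) (hz s' hs'.1 hs'.2).1
    (hz s hs.1 hs.2).1 (by rw [he, Pi.single_sub]; abel)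
  rwa [he] at this

end FlipSystem

theorem exists_avoiding_progressions {k t m m' : ℤ} (hk : 12 ≤ k) (ht : 0 < t)
    (htk : 3 * t ≤ k) :
    ∃ x, t ≤ x ∧ x < k - t ∧ x ≠ m ∧ x ≠ m + t ∧ x ≠ m' ∧ x ≠ m' + t := by
  by_contra! hc
  have h0 := hc t
  have h1 := hc (t + 1)
  have h2 := hc (t + 2)
  have h3 := hc (t + 3)
  have h4 := hc (t + 4)
  grind

theorem exists_avoiding_neighbors {k j m m' : ℤ} (hk : 12 ≤ k) (hj : 0 < j) (hj4 : j ≤ 4) :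
    ∃ x, j ≤ x ∧ x < k - j ∧ x ≠ m ∧ x ≠ m + j ∧ x ≠ m - j ∧ x ≠ m' := by
  by_contra! hc
  have h0 := hc j
  have h1 := hc (j + 1)
  have h2 := hc (j + 2)
  have h3 := hc (j + 3)
  have h4 := hc (j + 4)
  grind

namespace FlipSystem

theorem exists_axis_periodicOff {n k : ℕ} {Q : (Fin (n + 2) → ℤ) → Bool}
    {p : (Fin (n + 2) → ℤ) → (Fin (n + 2) → ℤ)} (h : FlipSystem (k : ℤ) Q p)
    (hk : 3 * 2 ^ (n + 2) ≤ k) :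
    ∃ (t : ℤ) (m m' : Fin (n + 2) → ℤ), 0 < t ∧ 3 * t ≤ k ∧
      PeriodicOff (k : ℤ) Q (Pi.single 0 t) {m, m'} := by
  have hkpos : 0 < k := lt_of_lt_of_le (by positivity) hk
  set L : ℤ := (k : ℤ) / 3 + 1 with hL
  have hLpos : 0 < L := by omega
  let cell : (Fin (n + 2) → ℤ) → (Fin (n + 2) → ℤ) := fun y =>
    Fin.cons (((y - p y) 0 + k - 1) / L) (fun i => (y - p y) i.succ)
  have hbound : ∀ y, InBox (k : ℤ) y → ∀ i, -(k : ℤ) < (y - p y) i ∧ (y - p y) i < k := by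
    intro y hy i
    have h1 := hy i
    have h2 := h.mem y hy i
    simp only [Pi.sub_apply]
    omega
  obtain ⟨y, hy, y', hy', hne, he⟩ := Finset.exists_ne_map_eq_of_card_lt_of_maps_to
    (s := Fintype.piFinset (fun _ : Fin (n + 2) => Finset.Ico (0 : ℤ) k))
    (t := Fintype.piFinset (Fin.cons (Finset.Ico (0 : ℤ) 6)
      (fun _ : Fin (n + 1) => Finset.Ioo (-(k : ℤ)) k) : Fin (n + 2) → Finset ℤ))
    (f := cell) (by
      rw [Fintype.card_piFinset, Fintype.card_piFinset, Fin.prod_univ_succ]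
      simp only [Fin.cons_zero, Fin.cons_succ, Int.card_Ico, Int.card_Ioo, Finset.prod_const,
        Finset.card_univ, Fintype.card_fin]
      have e1 : ((k : ℤ) - -(k : ℤ) - 1).toNat = 2 * k - 1 := by omega
      have e2 : ((k : ℤ) - 0).toNat = k := by omega
      have e3 : ((6 : ℤ) - 0).toNat = 6 := rfl
      rw [e1, e2, e3]
      calc 6 * (2 * k - 1) ^ (n + 1) < 6 * (2 * k) ^ (n + 1) := by
            gcongr
            omega
        _ = 3 * 2 ^ (n + 2) * k ^ (n + 1) := by rw [mul_pow]; ring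
        _ ≤ k * k ^ (n + 1) := by gcongr
        _ = k ^ (n + 2) := by ring) (by
      intro y hy
      have hy : InBox (k : ℤ) y := by simpa [InBox] using hy
      simp only [Finset.mem_coe, Fintype.mem_piFinset]
      intro i
      refine Fin.cases ?_ (fun i => ?_) i
      · have := hbound y hy 0
        simp only [cell, Fin.cons_zero, Finset.mem_Ico]
        refine ⟨Int.ediv_nonneg (by omega) hLpos.le, Int.ediv_lt_of_lt_mul hLpos ?_⟩
        omega
      · simpa [cell] using hbound y hy i.succ)
  replace hy : InBox (k : ℤ) y := by simpa [InBox] using hy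
  replace hy' : InBox (k : ℤ) y' := by simpa [InBox] using hy'
  wlog hlt : (y' - p y') 0 ≤ (y - p y) 0 generalizing y y'
  · exact this y' y hne.symm he.symm hy' hy (by omega)
  have hs : ∀ i : Fin (n + 1), (y - p y) i.succ = (y' - p y') i.succ := by
    intro i
    simpa [cell] using congrFun he i.succ
  have h0 : ((y - p y) 0 + k - 1) / L = ((y' - p y') 0 + k - 1) / L := by
    simpa [cell] using congrFun he 0
  have hu : Pi.single 0 ((y - p y) 0 - (y' - p y') 0) = (y - p y) - (y' - p y') := by
    funext i
    refine Fin.cases ?_ (fun i => ?_) i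
    · simp
    · have := hs i
      rw [Pi.sub_apply (y - p y), this]
      simp
  refine ⟨(y - p y) 0 - (y' - p y') 0, p y, p y' - Pi.single 0 ((y - p y) 0 - (y' - p y') 0),
    ?_, ?_, h.periodicOff_of_shift hy hy' hu⟩
  · rcases hlt.lt_or_eq with hlt | heq
    · omega
    · refine absurd (h.shift_injective hy hy' ?_) hne
      rw [← heq, sub_self, Pi.single_zero] at hu
      exact sub_eq_zero.1 hu.symm
  · have q1 := Int.emod_add_mul_ediv ((y - p y) 0 + k - 1) L
    have q2 := Int.emod_add_mul_ediv ((y' - p y') 0 + k - 1) L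
    have r1 := Int.emod_lt_of_pos ((y - p y) 0 + k - 1) hLpos
    have r2 := Int.emod_nonneg ((y' - p y') 0 + k - 1) hLpos.ne'
    rw [h0] at q1
    omega

variable {n : ℕ} {k : ℤ} {Q : (Fin (n + 2) → ℤ) → Bool}
  {p : (Fin (n + 2) → ℤ) → (Fin (n + 2) → ℤ)}

/-- If `Q` is periodic in direction `i` off `a`, then for `y` away from `a` the flipped entry
has index `a` or one of its neighbors in direction `i`. -/
theorem eq_or_eq_of_periodicOff (h : FlipSystem k Q p) {j : ℤ} {i : Fin (n + 2)}
    {a : Fin (n + 2) → ℤ} (hM : PeriodicOff k Q (Pi.single i j) {a, a - Pi.single i j})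
    (hj : 0 < j) {y : Fin (n + 2) → ℤ} (hy : InBox k y) (h0 : j ≤ y i) (h1 : y i < k - j)
    (hya : ¬ (y i = a i ∨ y i = a i + j ∨ y i = a i - j) ∨ ∃ l ≠ i, y l ≠ a l) :
    p y = a ∨ p y = a + Pi.single i j ∨ p y = a - Pi.single i j := by
  have hne : y ≠ a ∧ y ≠ a - Pi.single i j ∧ y ≠ a + Pi.single i j := by
    refine ⟨?_, ?_, ?_⟩ <;> rintro rfl <;> rcases hya with hya | ⟨l, hl, hya⟩ <;> simp_all
  have := h.mem_of_periodicOff hM hj hy h0 h1 (by simp [hne])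
    (by simp [hne, sub_eq_iff_eq_add])
  simp only [Set.mem_insert_iff, Set.mem_singleton_iff, sub_eq_iff_eq_add,
    sub_add_cancel] at this
  tauto

theorem exists_periodicOff_one (h : FlipSystem k Q p) (hk : 12 ≤ k) {t : ℤ}
    {m m' : Fin (n + 2) → ℤ} (ht : 0 < t) (htk : 3 * t ≤ k)
    (hM : PeriodicOff k Q (Pi.single 0 t) {m, m'}) :
    ∃ (j : ℤ) (a : Fin (n + 2) → ℤ), 0 < j ∧ j ≤ 4 ∧
      PeriodicOff k Q (Pi.single 1 j) {a, a - Pi.single 1 j} := by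
  obtain ⟨x, hx0, hx1, hm, hmt, hm', hmt'⟩ :=
    exists_avoiding_progressions (m := m 0) (m' := m' 0) hk ht htk
  refine h.exists_periodicOff (z := Pi.single 0 x) (N := 4)
    (S := {m, m', m + Pi.single 0 t, m' + Pi.single 0 t}) Finset.card_le_four ?_
  intro s hs0 hs4
  set y : Fin (n + 2) → ℤ := Pi.single 0 x + Pi.single 1 s with hydef
  have hy0 : y 0 = x := by simp [hydef]
  have hy : InBox k y := by
    have h1 : InBox k (Pi.single 0 x : Fin (n + 2) → ℤ) := by
      have := (inBox_zero (d := n + 2) (k := k) (by omega)).add_single (i := 0) (t := x)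
        (by simp; omega) (by simp; omega)
      simpa using this
    exact h1.add_single (by simp; omega) (by simp; omega)
  refine ⟨hy, ?_⟩
  have := h.mem_of_periodicOff hM ht hy (by omega) (by omega)
    (by
      simp only [Set.mem_insert_iff, Set.mem_singleton_iff, not_or]
      constructor <;> rintro e <;> have := congrFun e 0 <;> omega)
    (by
      simp only [Set.mem_insert_iff, Set.mem_singleton_iff, not_or]
      constructor <;> rintro e <;> have := congrFun e 0 <;> simp at this <;> omega)
  simp only [Set.mem_insert_iff, Set.mem_singleton_iff, sub_eq_iff_eq_add] at this
  simp only [Finset.mem_insert, Finset.mem_singleton]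
  tauto

theorem inBox_single_add_single (hk : 0 < k) {x r : ℤ} (hx0 : 0 ≤ x) (hx1 : x < k)
    (hr0 : 0 ≤ r) (hr1 : r < k) :
    InBox k (Pi.single 1 r + Pi.single 0 x : Fin (n + 2) → ℤ) := by
  have h1 : InBox k (Pi.single 1 r : Fin (n + 2) → ℤ) := by
    have := (inBox_zero (d := n + 2) hk).add_single (i := 1) (t := r)
      (by simpa using hr0) (by simpa using hr1)
    simpa using this
  exact h1.add_single (by simpa using hx0) (by simpa using hx1)

theorem exists_periodicOff_zero (h : FlipSystem k Q p) (hk : 12 ≤ k) {j : ℤ}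
    {a : Fin (n + 2) → ℤ} (hj : 0 < j) (hj4 : j ≤ 4)
    (hM : PeriodicOff k Q (Pi.single 1 j) {a, a - Pi.single 1 j}) :
    ∃ (j' : ℤ) (a' : Fin (n + 2) → ℤ), 0 < j' ∧ j' ≤ 3 ∧
      PeriodicOff k Q (Pi.single 0 j') {a', a' - Pi.single 0 j'} := by
  obtain ⟨r, hr0, hr1, h1, h2, h3, -⟩ :=
    exists_avoiding_neighbors (m := a 1) (m' := a 1) hk hj hj4
  refine h.exists_periodicOff (z := Pi.single 1 r) (N := 3)
    (S := {a, a + Pi.single 1 j, a - Pi.single 1 j}) Finset.card_le_three ?_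
  intro s hs0 hs3
  have hy := inBox_single_add_single (n := n) (k := k) (x := s) (r := r) (by omega) hs0
    (by push_cast at hs3; omega) (by omega) (by omega)
  refine ⟨hy, ?_⟩
  have := h.eq_or_eq_of_periodicOff hM hj hy (by simp; omega) (by simp; omega)
    (Or.inl (by simp; omega))
  simpa using this

/-- Many pairs of adjacent points have the same flipped entry `c`. -/
theorem exists_center (h : FlipSystem k Q p) (hk : 12 ≤ k) {j j' : ℤ}
    {a a' : Fin (n + 2) → ℤ} (hj : 0 < j) (hj4 : j ≤ 4) (hj' : 0 < j') (hj3 : j' ≤ 3)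
    (hM : PeriodicOff k Q (Pi.single 1 j) {a, a - Pi.single 1 j})
    (hM' : PeriodicOff k Q (Pi.single 0 j') {a', a' - Pi.single 0 j'}) :
    ∃ c, ∀ i, ∃ y, InBox k y ∧ InBox k (y + Pi.single i 1) ∧ p y = c ∧
      p (y + Pi.single i 1) = c := by
  obtain ⟨r, hr0, hr1, hra, hraj, hraj', hra'⟩ :=
    exists_avoiding_neighbors (m := a 1) (m' := a' 1) hk hj hj4
  obtain ⟨x, hx0, hx1, hxa, hxaj, hxaj', hxa'⟩ :=
    exists_avoiding_neighbors (m := a' 0) (m' := a 0) hk hj' (by omega)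
  have key : ∀ y, InBox k y → j ≤ y 1 → y 1 < k - j → j' ≤ y 0 → y 0 < k - j' →
      (y 1 = r ∨ y 0 = x) → p y = Function.update a 1 (a' 1) := by
    intro y hy h1 h2 h3 h4 h5
    have e1 := h.eq_or_eq_of_periodicOff hM hj hy h1 h2 (by
      rcases h5 with h5 | h5
      · left; omega
      · exact Or.inr ⟨0, by simp, by omega⟩)
    have e2 := h.eq_or_eq_of_periodicOff hM' hj' hy h3 h4 (by
      rcases h5 with h5 | h5
      · exact Or.inr ⟨1, by simp, by omega⟩
      · left; omega)
    funext i
    rcases eq_or_ne i 1 with rfl | hi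
    · rcases e2 with e | e | e <;> simp [e]
    · rcases e1 with e | e | e <;> simp [e, hi]
  refine ⟨Function.update a 1 (a' 1), fun i => ?_⟩
  rcases eq_or_ne i 1 with rfl | hi
  · have hy := inBox_single_add_single (n := n) (k := k) (x := x) (r := j) (by omega)
      (by omega) (by omega) (by omega) (by omega)
    have hy1 := hy.add_single (i := 1) (t := 1) (by simp; omega) (by simp; omega)
    refine ⟨_, hy, hy1, key _ hy ?_ ?_ ?_ ?_ ?_, key _ hy1 ?_ ?_ ?_ ?_ ?_⟩ <;> simp <;> omega
  · have hy := inBox_single_add_single (n := n) (k := k) (x := j') (r := r) (by omega)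
      (by omega) (by omega) (by omega) (by omega)
    have hy1 : InBox k (Pi.single 1 r + Pi.single 0 j' + Pi.single i 1 : Fin (n + 2) → ℤ) := by
      rcases eq_or_ne i 0 with rfl | hi0
      · exact hy.add_single (by simp; omega) (by simp; omega)
      · exact hy.add_single (by simp [hi, hi0]) (by simp [hi, hi0]; omega)
    refine ⟨_, hy, hy1, key _ hy ?_ ?_ ?_ ?_ ?_, key _ hy1 ?_ ?_ ?_ ?_ ?_⟩
    all_goals rcases eq_or_ne i 0 with rfl | hi0
    all_goals simp [hi.symm]
    all_goals try simp [hi0.symm]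
    all_goals omega

end FlipSystem

theorem eq_apply_zero_of_forall_add_single {d : ℕ} {k : ℤ} {R : (Fin d → ℤ) → Bool}
    (hR : ∀ i w, InBox k w → InBox k (w + Pi.single i 1) → R w = R (w + Pi.single i 1))
    {w : Fin d → ℤ} (hw : InBox k w) : R w = R 0 := by
  induction hN : ∑ i, (w i).toNat generalizing w with
  | zero =>
    congr
    funext i
    have h1 : (w i).toNat = 0 := by
      simpa using (Finset.sum_eq_zero_iff.1 hN) i (Finset.mem_univ i)
    have := (hw i).1
    simp only [Pi.zero_apply]
    omega
  | succ N ih =>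
    obtain ⟨i, -, hi⟩ : ∃ i ∈ Finset.univ, (w i).toNat ≠ 0 := by
      by_contra! hc
      rw [Finset.sum_eq_zero hc] at hN
      omega
    have hi' := hw i
    have hv : InBox k (w - Pi.single i 1) := hw.sub_single (by omega) (by omega)
    rw [← ih hv, hR i _ hv (by simpa using hw), sub_add_cancel]
    have h1 := Finset.add_sum_erase Finset.univ (fun l => (w l).toNat) (Finset.mem_univ i)
    have h2 := Finset.add_sum_erase Finset.univ
      (fun l => ((w - Pi.single i 1 : Fin d → ℤ) l).toNat) (Finset.mem_univ i)
    have h3 : ∑ l ∈ Finset.univ.erase i, ((w - Pi.single i 1 : Fin d → ℤ) l).toNat =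
        ∑ l ∈ Finset.univ.erase i, (w l).toNat := by
      refine Finset.sum_congr rfl fun l hl => ?_
      simp [Finset.ne_of_mem_erase hl]
    simp only [Pi.sub_apply, Pi.single_eq_same] at h1 h2 h3 ⊢
    omega

namespace FlipSystem

/-- A pattern admitting a flip system is constant but for one corner. -/
theorem exists_corner {n k : ℕ} {Q : (Fin (n + 2) → ℤ) → Bool}
    {p : (Fin (n + 2) → ℤ) → (Fin (n + 2) → ℤ)} (h : FlipSystem (k : ℤ) Q p)
    (hk : 3 * 2 ^ (n + 2) ≤ k) :
    ∃ c, InBox (k : ℤ) c ∧ (∀ i, c i = 0 ∨ c i = k - 1) ∧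
      ∀ z, InBox (k : ℤ) z → z ≠ c → Q z = !Q c := by
  have hk12 : (12 : ℤ) ≤ k := by
    have : 1 ≤ 2 ^ n := Nat.one_le_two_pow
    rw [pow_add] at hk
    omega
  obtain ⟨t, m, m', ht, htk, hM⟩ := h.exists_axis_periodicOff hk
  obtain ⟨j, a, hj, hj4, hM1⟩ := h.exists_periodicOff_one hk12 ht htk hM
  obtain ⟨j', a', hj', hj3, hM2⟩ := h.exists_periodicOff_zero hk12 hj hj4 hM1
  obtain ⟨c, hc⟩ := h.exists_center hk12 hj hj4 hj' hj3 hM1 hM2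
  have hcB : InBox (k : ℤ) c := by
    obtain ⟨y, hy, -, e, -⟩ := hc 0
    exact e ▸ h.mem y hy
  let R : (Fin (n + 2) → ℤ) → Bool := fun z => if z = c then !Q c else Q z
  have hR : ∀ i w, InBox (k : ℤ) w → InBox (k : ℤ) (w + Pi.single i 1) →
      R w = R (w + Pi.single i 1) := by
    intro i w hw hwi
    obtain ⟨y, hy, hyi, e, ei⟩ := hc i
    by_cases h1 : w = c
    · subst h1
      have := h.ne_of_shift_eq (y + Pi.single i 1) y (w + Pi.single i 1) hyi hy hwi
        (by rw [e]; abel) (by rw [e]; simp)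
      rw [ei] at this
      simpa [R, Bool.eq_not] using (Bool.eq_not.2 this.symm).symm
    · by_cases h2 : w + Pi.single i 1 = c
      · have := h.ne_of_shift_eq y (y + Pi.single i 1) w hy hyi hw
          (by rw [ei, ← h2]; abel) (by rwa [ei])
        rw [e] at this
        simpa [R, h1, h2] using Bool.eq_not.2 this.symm
      · have hp := h.periodicOff_of_shift (u := Pi.single i 1) hyi hy (by rw [e, ei]; abel)
        rw [e, ei] at hp
        have := hp w hw hwi (by simp [h1, eq_sub_iff_add_eq, h2])
        simpa [R, h1, h2] using this
  have hconst : ∀ z, InBox (k : ℤ) z → z ≠ c → Q z = !Q c := by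
    intro z hz hzc
    have := (eq_apply_zero_of_forall_add_single hR hz).trans
      (eq_apply_zero_of_forall_add_single hR hcB).symm
    simpa [R, hzc] using this
  refine ⟨c, hcB, fun i => ?_, hconst⟩
  by_contra hci
  have hci' := hcB i
  have hy : InBox (k : ℤ) (c + Pi.single i 1) := hcB.add_single (by omega) (by omega)
  have hw : InBox (k : ℤ) (c - Pi.single i 1) := hcB.sub_single (by omega) (by omega)
  have hp : p (c + Pi.single i 1) = c := by
    by_contra hp
    apply h.ne _ hy
    rw [hconst _ (h.mem _ hy) hp, hconst _ hy (by simp)]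
  have e : c - Pi.single i 1 + (c + Pi.single i 1 - c) = c := by abel
  have := h.eq_shift _ (c - Pi.single i 1) hy hw (by rwa [hp, e]) (by rw [hp]; simp)
  rw [hp, e, hconst _ hw (by simp)] at this
  simp at this

end FlipSystem

theorem exists_flipSystem_of_not_removable {d k : ℕ} {P : (Fin d → ℕ) → Bool}
    (hP : ¬ Removable d k P) :
    ∃ p, FlipSystem (k : ℤ) (fun z : Fin d → ℤ => P fun i => (z i).toNat) p := by
  simp only [Removable, not_forall, not_exists, not_and] at hP
  obtain ⟨n, A, x, hx, hP⟩ := hP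
  have key : ∀ y : Fin d → ℤ, ∃ q : Fin d → ℤ, InBox (k : ℤ) y → InBox (k : ℤ) q ∧
      P (fun i => (q i).toNat) ≠ P (fun i => (y i).toNat) ∧
      ∀ w : Fin d → ℤ, InBox (k : ℤ) w → w ≠ q →
        A (fun i => (x i + (w + (y - q)) i).toNat) = P fun i => (w i).toNat := by
    intro y
    by_cases hy : InBox (k : ℤ) y
    swap
    · exact ⟨0, fun h => absurd h hy⟩
    obtain ⟨x', hc, hn⟩ := hP (fun i => (y i).toNat) (!A fun i => x i + (y i).toNat)
      (fun i => by have := hy i; omega) (by simp)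
    have hmiss : ∀ w : Fin d → ℕ, (∀ i, w i < k) →
        (fun i => x' i + w i) ≠ (fun i => x i + (y i).toNat) →
        A (fun i => x' i + w i) = P w := by
      intro w hw hne
      have := hc.2 w hw
      rwa [Function.update_of_ne hne] at this
    obtain ⟨q, hq, hqA⟩ : ∃ q : Fin d → ℕ, (∀ i, q i < k) ∧ A (fun i => x' i + q i) ≠ P q := by
      by_contra! hall
      exact hn ⟨hc.1, hall⟩
    have hq' : (fun i => x' i + q i) = (fun i => x i + (y i).toNat) := by
      by_contra hne
      exact hqA (hmiss q hq hne)
    have hqi : ∀ i, x' i + q i = x i + (y i).toNat := congrFun hq'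
    refine ⟨fun i => (q i : ℤ), fun _ => ⟨fun i => ?_, ?_, ?_⟩⟩
    · have := hq i
      dsimp only
      omega
    · rw [hq', hx.2 _ (fun i => by have := hy i; omega)] at hqA
      simpa using hqA.symm
    · intro w hw hwq
      have e : (fun i => ((x i : ℤ) + (w + (y - fun i => (q i : ℤ))) i).toNat) =
          fun i => x' i + (w i).toNat := by
        funext i
        have h1 := hqi i
        have h2 := hy i
        have h3 := hw i
        simp only [Pi.add_apply, Pi.sub_apply]
        omega
      rw [e]
      refine hmiss _ (fun i => by have := hw i; omega) fun hne => hwq ?_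
      funext i
      have h1 := hqi i
      have h2 := congrFun hne i
      have h3 := hw i
      omega
  choose p hp using key
  have hxz : ∀ w : Fin d → ℤ, InBox (k : ℤ) w →
      A (fun i => (x i + w i).toNat) = P fun i => (w i).toNat := by
    intro w hw
    rw [← hx.2 _ (fun i => by have := hw i; omega)]
    congr
    funext i
    have := hw i
    omega
  refine ⟨p, fun y hy => (hp y hy).1, fun y hy => (hp y hy).2.1, ?_, ?_, ?_⟩
  · intro y w hy hw hwy hne
    rw [← (hp y hy).2.2 w hw hne, hxz _ hwy]
  · intro y y' w w' hy hy' hw hw' he hne hne'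
    rw [← (hp y hy).2.2 w hw hne, ← (hp y' hy').2.2 w' hw' hne', he]
  · intro y y' w' hy hy' hw' he hne
    rw [← (hp y' hy').2.2 w' hw' hne, ← he, hxz y hy]
    exact (hp y hy).2.1

/-- Any large enough binary pattern (of dimension `d ≥ 2`) which is not almost
homogeneous is removable. -/
theorem stmt0 (d k : ℕ) (hd : 2 ≤ d) (hk : 3 * 2 ^ d ≤ k)
    (P : (Fin d → ℕ) → Bool) (hP : ¬ AlmostHomogeneous d k P) :
    Removable d k P := by
  by_contra hR
  obtain ⟨p, h⟩ := exists_flipSystem_of_not_removable hR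
  obtain ⟨n, rfl⟩ := Nat.exists_eq_add_of_le' hd
  obtain ⟨c, hcB, hc, hconst⟩ := h.exists_corner hk
  refine hP ⟨fun i => (c i).toNat, _, _, fun i => ?_, Bool.not_ne_self _, rfl, fun y hy hne => ?_⟩
  · have := hc i
    have := hcB i
    dsimp only
    omega
  · have := hconst (fun i => (y i : ℤ)) (fun i => by have := hy i; dsimp only; omega) (by
      rintro rfl
      exact hne (by simp))
    simpa using this
end

section
/- Let d ≥ 1, k ≥ 2, and let P be a d-dimensional pattern of side length k over {0,1} that is almost homogeneous. Then P is not removable over {0,1}: there exist a binary d-dimensional array A and a copy of P in A starting at some x such that for every y ∈ [k]^d, the array obtained from A by flipping the entry at x+y contains a copy of P starting at some position where A contains no copy of P. -/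
/-- A binary pattern is not removable as soon as some array contains a copy of it each of whose
entries, when flipped, creates a new copy. -/
theorem not_removable_of_flip_creates_copy {d k : ℕ} {P : (Fin d → ℕ) → Bool}
    (h : ∃ (n : ℕ) (A : (Fin d → ℕ) → Bool) (x : Fin d → ℕ),
      HasCopy d n k A P x ∧
      ∀ y : Fin d → ℕ, (∀ i, y i < k) →
        ∃ q : Fin d → ℕ,
          HasCopy d n k
            (Function.update A (fun i => x i + y i) (!(A (fun i => x i + y i)))) P q ∧
          ¬ HasCopy d n k A P q) :
    ¬ Removable d k P := by
  obtain ⟨n, A, x, hx, h⟩ := h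
  intro hR
  obtain ⟨y, σ, hy, hσ, hcopy⟩ := hR n A x hx
  obtain ⟨q, hq, hq'⟩ := h y hy
  rw [← Bool.eq_not.mpr hσ] at hq
  exact hq' (hcopy q hq)

/-- For an almost homogeneous binary pattern, take the array whose only two exceptional entries
lie at the exceptional corner of a copy and at its neighbour outside of the copy. -/
theorem exists_copy_flip_creates_copy {d k : ℕ} (hd : 1 ≤ d) (hk : 2 ≤ k)
    {P : (Fin d → ℕ) → Bool} (hP : AlmostHomogeneous d k P) :
    ∃ (n : ℕ) (A : (Fin d → ℕ) → Bool) (x : Fin d → ℕ),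
      HasCopy d n k A P x ∧
      ∀ y : Fin d → ℕ, (∀ i, y i < k) →
        ∃ q : Fin d → ℕ,
          HasCopy d n k
            (Function.update A (fun i => x i + y i) (!(A (fun i => x i + y i)))) P q ∧
          ¬ HasCopy d n k A P q := by
  obtain ⟨c, a, b, hc, hab, hPc, hPa⟩ := hP
  have hba : (!b) = a := by cases a <;> cases b <;> simp_all
  have hab' : (!a) = b := by cases a <;> cases b <;> simp_all
  have hck : ∀ i, c i < k := fun i => by rcases hc i with h | h <;> omega
  let i₀ : Fin d := ⟨0, hd⟩
  let p : Fin d → ℕ := fun i => k + c i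
  let v : Fin d → ℕ := Function.update p i₀ (if c i₀ = 0 then k - 1 else 2 * k)
  let A : (Fin d → ℕ) → Bool := fun z => if z = p ∨ z = v then b else a
  have hvi : v i₀ = if c i₀ = 0 then k - 1 else 2 * k := Function.update_self ..
  have hvp : v ≠ p := fun h => by
    have h₁ : v i₀ = k + c i₀ := congrFun h i₀
    have := hc i₀
    split_ifs at hvi <;> omega
  have hAp : A p = b := if_pos (Or.inl rfl)
  have hAv : A v = b := if_pos (Or.inr rfl)
  have hA : ∀ z, z ≠ p → z ≠ v → A z = a := fun z h₁ h₂ => if_neg (by tauto)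
  have hxv : ∀ y : Fin d → ℕ, (∀ i, y i < k) → (fun i => k + y i) ≠ v := fun y hy h => by
    have h₁ : k + y i₀ = v i₀ := congrFun h i₀
    have := hy i₀
    split_ifs at hvi <;> omega
  have hxp : ∀ y : Fin d → ℕ, y ≠ c → (fun i => k + y i) ≠ p := fun y hy h =>
    hy (funext fun i => Nat.add_left_cancel (congrFun h i))
  refine ⟨3 * k, A, fun _ => k, ⟨fun i => (by omega : k + k ≤ 3 * k), fun y hy => ?_⟩, fun y hy => ?_⟩
  · by_cases hyc : y = c
    · subst hyc
      exact hAp.trans hPc.symm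
    · rw [hA _ (hxp y hyc) (hxv y hy), hPa y hy hyc]
  by_cases hyc : y = c
  · subst y
    let q : Fin d → ℕ := Function.update (fun _ => k) i₀ (if c i₀ = 0 then k - 1 else k + 1)
    have hqi : q i₀ = if c i₀ = 0 then k - 1 else k + 1 := Function.update_self ..
    have hqj : ∀ j, j ≠ i₀ → q j = k := fun j hj => Function.update_of_ne hj ..
    have hvj : ∀ j, j ≠ i₀ → v j = k + c j := fun j hj => Function.update_of_ne hj ..
    have hqc : (fun i => q i + c i) = v := by
      funext i
      by_cases hi : i = i₀
      · subst hi
        have := hc i₀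
        rw [hqi, hvi]
        split_ifs <;> omega
      · rw [hqj i hi, hvj i hi]
    refine ⟨q, ⟨fun i => ?_, fun y hy => ?_⟩, fun hcopy => ?_⟩
    · by_cases hi : i = i₀
      · subst hi
        rw [hqi]
        split_ifs <;> omega
      · rw [hqj i hi]
        omega
    · change Function.update A p (!(A p)) _ = _
      rw [hAp, hba]
      by_cases hyc : y = c
      · subst hyc
        rw [hqc, Function.update_of_ne hvp, hAv, hPc]
      · rw [hPa y hy hyc]
        by_cases hyp : (fun i => q i + y i) = p
        · rw [hyp, Function.update_self]
        · rw [Function.update_of_ne hyp]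
          refine hA _ hyp fun h => hyc (funext fun i => ?_)
          exact Nat.add_left_cancel (congrFun (h.trans hqc.symm) i)
    · let w : Fin d → ℕ := Function.update c i₀ (if c i₀ = 0 then 1 else k - 2)
      have hwi : w i₀ = if c i₀ = 0 then 1 else k - 2 := Function.update_self ..
      have hwj : ∀ j, j ≠ i₀ → w j = c j := fun j hj => Function.update_of_ne hj ..
      have hwk : ∀ i, w i < k := fun i => by
        by_cases hi : i = i₀
        · subst hi
          rw [hwi]
          split_ifs <;> omega
        · rw [hwj i hi]
          exact hck i
      have hwc : w ≠ c := fun h => by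
        have h₁ := congrFun h i₀
        have := hc i₀
        split_ifs at hwi <;> omega
      have hqw : (fun i => q i + w i) = p := by
        funext i
        change q i + w i = k + c i
        by_cases hi : i = i₀
        · subst hi
          have := hc i₀
          rw [hqi, hwi]
          split_ifs <;> omega
        · rw [hqj i hi, hwj i hi]
      have := hcopy.2 w hwk
      rw [hqw, hAp, hPa w hwk hwc] at this
      exact hab this.symm
  · have hAy : A (fun i => k + y i) = a := hA _ (hxp y hyc) (hxv y hy)
    have hqc : (fun i => k + y i - c i + c i) = fun i => k + y i :=
      funext fun i => by have := hck i; omega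
    refine ⟨fun i => k + y i - c i, ⟨fun i => ?_, fun z hz => ?_⟩, fun hcopy => ?_⟩
    · have := hy i
      change k + y i - c i + k ≤ 3 * k
      omega
    · rw [hAy, hab']
      by_cases hzc : z = c
      · subst hzc
        rw [hqc, Function.update_self, hPc]
      · have hzy : (fun i => k + y i - c i + z i) ≠ fun i => k + y i := fun h =>
          hzc (funext fun i => by
            have h₁ : k + y i - c i + z i = k + y i := congrFun h i
            have := hck i
            omega)
        rw [Function.update_of_ne hzy, hPa z hz hzc]
        refine hA _ (fun h => hyc (funext fun i => ?_)) fun h => ?_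
        · have h₁ : k + y i - c i + z i = k + c i := congrFun h i
          have := hc i
          have := hy i
          have := hz i
          omega
        · have h₁ : k + y i₀ - c i₀ + z i₀ = v i₀ := congrFun h i₀
          have := hc i₀
          have := hy i₀
          have := hz i₀
          split_ifs at hvi <;> omega
    · have := hcopy.2 c hck
      rw [hqc, hAy, hPc] at this
      exact hab this


/-- An almost homogeneous binary pattern is not removable: there is a binary array `A`
with a copy of `P` starting at some `x` such that flipping any entry of this copy
creates a copy of `P` at a position where `A` had no copy. -/
theorem stmt1 (d k : ℕ) (hd : 1 ≤ d) (hk : 2 ≤ k)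
    (P : (Fin d → ℕ) → Bool) (hP : AlmostHomogeneous d k P) :
    ¬ Removable d k P ∧
    ∃ (n : ℕ) (A : (Fin d → ℕ) → Bool) (x : Fin d → ℕ),
      HasCopy d n k A P x ∧
      ∀ y : Fin d → ℕ, (∀ i, y i < k) →
        ∃ q : Fin d → ℕ,
          HasCopy d n k
            (Function.update A (fun i => x i + y i) (!(A (fun i => x i + y i)))) P q ∧
          ¬ HasCopy d n k A P q := by
  exact ⟨not_removable_of_flip_creates_copy (exists_copy_flip_creates_copy hd hk hP),
    exists_copy_flip_creates_copy hd hk hP⟩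
end

section
/- Let d ≥ 2, let Γ be a finite alphabet with |Γ| ≥ 3, and let P be a d-dimensional pattern of side length k over Γ with k ≥ 3·2^d. Then P is removable over Γ. -/
/-- The pattern `P` placed at `x'` agrees with `A` everywhere except at the single position `w`,
which corresponds to the position `r` of `P`. -/
def IsNearCopy {Γ : Type*} {d : ℕ} (k : ℕ) (A P : (Fin d → ℕ) → Γ) (w x' r : Fin d → ℕ) : Prop :=
  (∀ i, r i < k) ∧ x' + r = w ∧ A w ≠ P r ∧
    ∀ z : Fin d → ℕ, (∀ i, z i < k) → z ≠ r → A (x' + z) = P z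

/-- If no single modification removes the copy at `x`, every modification inside this copy is
witnessed by a near copy. -/
theorem exists_isNearCopy {Γ : Type*} [DecidableEq Γ] {d n k : ℕ} {A P : (Fin d → ℕ) → Γ}
    {x : Fin d → ℕ}
    (hno : ¬ ∃ (y : Fin d → ℕ) (σ : Γ), (∀ i, y i < k) ∧ σ ≠ A (fun i => x i + y i) ∧
      ∀ x' : Fin d → ℕ, HasCopy d n k (Function.update A (fun i => x i + y i) σ) P x' →
        HasCopy d n k A P x')
    {y : Fin d → ℕ} (hy : ∀ i, y i < k) {σ : Γ} (hσ : σ ≠ A (x + y)) :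
    ∃ x' r, IsNearCopy k A P (x + y) x' r ∧ P r = σ := by
  by_contra hcon
  refine hno ⟨y, σ, hy, hσ, fun x' hx' => ⟨hx'.1, fun z hz => ?_⟩⟩
  have hupd := hx'.2
  change ∀ z : Fin d → ℕ, (∀ i, z i < k) →
    Function.update A (x + y) σ (x' + z) = P z at hupd
  change A (x' + z) = P z
  by_cases hzy : x' + z = x + y
  · have hPz : P z = σ := by rw [← hupd z hz, hzy, Function.update_self]
    refine absurd ⟨x', z, ⟨hz, hzy, hPz ▸ hσ.symm, fun z' hz' hne => ?_⟩, hPz⟩ hcon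
    rw [← hupd z' hz', Function.update_of_ne]
    exact fun h => hne (add_left_cancel (h.trans hzy.symm))
  · rw [← hupd z hz, Function.update_of_ne hzy]

theorem six_mul_pow_lt_pow {d k : ℕ} (hd : 2 ≤ d) (hk : 3 * 2 ^ d ≤ k) :
    6 * (2 * k - 1) ^ (d - 1) < k ^ d := by
  obtain ⟨e, rfl⟩ : ∃ e, d = e + 1 := ⟨d - 1, by omega⟩
  have hpow : 0 < 2 ^ (e + 1) := by positivity
  have hlt : (2 * k - 1) ^ e < (2 * k) ^ e := Nat.pow_lt_pow_left (by omega) (by omega)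
  calc 6 * (2 * k - 1) ^ (e + 1 - 1) < 6 * (2 * k) ^ e := by simpa using hlt
    _ = (3 * 2 ^ (e + 1)) * k ^ e := by rw [mul_pow, pow_succ]; ring
    _ ≤ k * k ^ e := Nat.mul_le_mul_right _ hk
    _ = k ^ (e + 1) := by rw [pow_succ']

/-- An injective family of offsets indexed by the positions of a box contains two offsets that
differ by a short vector parallel to a given axis. -/
theorem exists_offsets_differ_on_axis {d k : ℕ} (hd : 2 ≤ d) (hk : 3 * 2 ^ d ≤ k) (i₀ : Fin d)
    (x : Fin d → ℕ) (f : (Fin d → ℕ) → Fin d → ℕ)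
    (hf : ∀ y : Fin d → ℕ, (∀ i, y i < k) → ∀ i, f y i ≤ x i + y i ∧ x i + y i < f y i + k)
    (hinj : ∀ y y' : Fin d → ℕ, (∀ i, y i < k) → (∀ i, y' i < k) → f y = f y' → y = y') :
    ∃ y y' : Fin d → ℕ, (∀ i, y i < k) ∧ (∀ i, y' i < k) ∧
      ∃ h, 0 < h ∧ 3 * h ≤ k ∧ f y' = f y + Pi.single i₀ h := by
  classical
  let key : (Fin d → ℕ) → Fin d → ℕ := fun y i =>
    if i = i₀ then (f y i + k - 1 - x i) / (k / 3 + 1) else f y i + k - 1 - x i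
  let S := Fintype.piFinset fun _ : Fin d => Finset.range k
  let R := Fintype.piFinset fun i : Fin d =>
    Finset.range (Function.update (fun _ : Fin d => 2 * k - 1) i₀ 6 i)
  have hS : ∀ y, y ∈ S ↔ ∀ i, y i < k := fun y => by simp [S]
  have hcard : R.card < S.card := by
    simp only [R, S, Fintype.card_piFinset, Finset.card_range]
    rw [Finset.prod_update_of_mem (Finset.mem_univ i₀)]
    simpa [Finset.card_sdiff] using six_mul_pow_lt_pow hd hk
  have hmaps : ∀ y ∈ S, key y ∈ R := by
    intro y hy
    rw [hS] at hy
    simp only [R, Fintype.mem_piFinset, Finset.mem_range]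
    intro i
    have h1 := hf y hy i
    have h2 := hy i
    by_cases hi : i = i₀
    · subst hi
      simp only [key, if_true, Function.update_self]
      rw [Nat.div_lt_iff_lt_mul (by omega)]
      omega
    · simp only [key, if_neg hi, Function.update_of_ne hi]
      omega
  obtain ⟨y, hy, y', hy', hne, heq⟩ := Finset.exists_ne_map_eq_of_card_lt_of_maps_to hcard hmaps
  rw [hS] at hy hy'
  have hoff : ∀ i, i ≠ i₀ → f y i = f y' i := by
    intro i hi
    have h := congrFun heq i
    simp only [key, if_neg hi] at h
    have h1 := hf y hy i
    have h2 := hf y' hy' i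
    have h3 := hy i
    have h4 := hy' i
    omega
  have hon : (f y i₀ + k - 1 - x i₀) / (k / 3 + 1) = (f y' i₀ + k - 1 - x i₀) / (k / 3 + 1) := by
    have h := congrFun heq i₀
    simpa only [key, if_true] using h
  have hdiff : f y i₀ ≠ f y' i₀ := by
    intro h
    refine hne (hinj y y' hy hy' (funext fun i => ?_))
    by_cases hi : i = i₀
    · rw [hi, h]
    · exact hoff i hi
  have h1 := hf y hy i₀
  have h2 := hf y' hy' i₀
  have h3 := hy i₀
  have h4 := hy' i₀
  have hm1 := Nat.div_add_mod (f y i₀ + k - 1 - x i₀) (k / 3 + 1)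
  have hm2 := Nat.div_add_mod (f y' i₀ + k - 1 - x i₀) (k / 3 + 1)
  have hl1 := Nat.mod_lt (f y i₀ + k - 1 - x i₀) (Nat.succ_pos (k / 3))
  have hl2 := Nat.mod_lt (f y' i₀ + k - 1 - x i₀) (Nat.succ_pos (k / 3))
  rw [Nat.succ_eq_add_one] at hl1 hl2
  rw [hon] at hm1
  rcases lt_or_gt_of_ne hdiff with hlt | hlt
  · refine ⟨y, y', hy, hy', f y' i₀ - f y i₀, by omega, by omega, funext fun i => ?_⟩
    by_cases hi : i = i₀
    · subst hi
      simp only [Pi.add_apply, Pi.single_eq_same]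
      omega
    · simp [hi, hoff i hi]
  · refine ⟨y', y, hy', hy, f y i₀ - f y' i₀, by omega, by omega, funext fun i => ?_⟩
    by_cases hi : i = i₀
    · subst hi
      simp only [Pi.add_apply, Pi.single_eq_same]
      omega
    · simp [hi, hoff i hi]

theorem IsNearCopy.position_eq {Γ : Type*} {d k : ℕ} {A P : (Fin d → ℕ) → Γ}
    {w w' x' r r' : Fin d → ℕ} (h : IsNearCopy k A P w x' r) (h' : IsNearCopy k A P w' x' r') :
    w = w' := by
  by_contra hne
  have hr : r ≠ r' := by
    rintro rfl
    exact hne (h.2.1.symm.trans h'.2.1)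
  refine h.2.2.1 ?_
  rw [← h.2.1]
  exact h'.2.2.2 r h.1 hr

/-- Two near copies whose offsets differ by `δ` force `P` to be `δ`-periodic away from two
positions. -/
theorem IsNearCopy.eq_or_eq_of_apply_ne {Γ : Type*} {d k : ℕ} {A P : (Fin d → ℕ) → Γ}
    {w w' x' r r' δ : Fin d → ℕ} (h : IsNearCopy k A P w x' r)
    (h' : IsNearCopy k A P w' (x' + δ) r') {z : Fin d → ℕ} (hz : ∀ i, z i < k)
    (hzδ : ∀ i, (z + δ) i < k) (hne : P z ≠ P (z + δ)) : z = r' ∨ z + δ = r := by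
  by_contra! hcon
  refine hne ?_
  rw [← h'.2.2.2 z hz hcon.1, ← h.2.2.2 _ hzδ hcon.2, add_assoc, add_comm δ z]

section Hubs

variable {Γ : Type*} {d k : ℕ} {A P : (Fin d → ℕ) → Γ} {x : Fin d → ℕ}

theorem IsNearCopy.apply_add (hA : ∀ z : Fin d → ℕ, (∀ i, z i < k) → A (x + z) = P z)
    {p x' r δ : Fin d → ℕ} (h : IsNearCopy k A P (x + p) x' r) (hδ : δ ≠ 0)
    (hr : ∀ i, (r + δ) i < k) (hp : ∀ i, (p + δ) i < k) : P (r + δ) = P (p + δ) := by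
  rw [← hA _ hp, ← h.2.2.2 _ hr (by simpa using hδ), ← add_assoc, h.2.1, add_assoc]

theorem IsNearCopy.apply_of_add_eq (hA : ∀ z : Fin d → ℕ, (∀ i, z i < k) → A (x + z) = P z)
    {p p' x' r q δ : Fin d → ℕ} (h : IsNearCopy k A P (x + p) x' r) (hδ : δ ≠ 0)
    (hq : q + δ = r) (hp' : p' + δ = p) (hqk : ∀ i, q i < k) (hpk : ∀ i, p' i < k) :
    P q = P p' := by
  have hqr : q ≠ r := by
    rw [← hq]
    simpa using hδ
  rw [← hA _ hpk, ← h.2.2.2 _ hqk hqr]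
  congr 1
  have := h.2.1
  rw [← hq, ← hp', ← add_assoc, ← add_assoc] at this
  exact add_right_cancel this

theorem lt_of_add_single_lt {i₀ : Fin d} {h : ℕ} {z : Fin d → ℕ} (hz : ∀ i, z i < k)
    (hi : z i₀ + h < k) : ∀ i, (z + Pi.single i₀ h : Fin d → ℕ) i < k := by
  intro i
  by_cases hii : i = i₀
  · subst hii
    simpa using hi
  · simpa [hii] using hz i

theorem exists_add_single_eq {i₀ : Fin d} {h : ℕ} {z : Fin d → ℕ} (hz : ∀ i, z i < k)
    (hi : h ≤ z i₀) : ∃ q : Fin d → ℕ, q + Pi.single i₀ h = z ∧ ∀ i, q i < k := by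
  refine ⟨z - Pi.single i₀ h, funext fun i => ?_, fun i => lt_of_le_of_lt ?_ (hz i)⟩
  · by_cases hii : i = i₀
    · subst hii
      simpa using Nat.sub_add_cancel hi
    · simp [hii]
  · simp

/-- The end of the mismatch `z, z + δ` that lies close to the boundary of the box. -/
def boundaryEnd (i₀ : Fin d) (h : ℕ) (z : Fin d → ℕ) : Fin d → ℕ :=
  if z i₀ < h then z else z + Pi.single i₀ h

/-- If `P` is periodic along an axis away from two positions, every generic position has near
copies whose defects are the boundary ends of the two mismatches. -/
theorem exists_isNearCopy_boundaryEnd [Fintype Γ] (hΓ : 3 ≤ Fintype.card Γ)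
    (hA : ∀ z : Fin d → ℕ, (∀ i, z i < k) → A (x + z) = P z)
    (hN : ∀ y : Fin d → ℕ, (∀ i, y i < k) → ∀ σ, σ ≠ P y →
      ∃ x' r, IsNearCopy k A P (x + y) x' r ∧ P r = σ)
    {i₀ : Fin d} {h : ℕ} (hpos : 0 < h) (h3 : 3 * h ≤ k) {z₁ z₂ : Fin d → ℕ}
    (hM : ∀ z : Fin d → ℕ, (∀ i, z i < k) → (∀ i, (z + Pi.single i₀ h : Fin d → ℕ) i < k) →
      P z ≠ P (z + Pi.single i₀ h) → z = z₁ ∨ z = z₂)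
    {p q : Fin d → ℕ} (hp : ∀ i, p i < k) (hpk : p i₀ + h < k) (hqk : ∀ i, q i < k)
    (hq : q + Pi.single i₀ h = p) (hpadd : P (p + Pi.single i₀ h) = P p) (hPq : P q = P p) :
    (∃ x', IsNearCopy k A P (x + p) x' (boundaryEnd i₀ h z₁)) ∧
      (∃ x', IsNearCopy k A P (x + p) x' (boundaryEnd i₀ h z₂)) ∧
        boundaryEnd i₀ h z₁ ≠ boundaryEnd i₀ h z₂ := by
  classical
  have hδ : (Pi.single i₀ h : Fin d → ℕ) ≠ 0 := by simpa using hpos.ne'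
  set δ : Fin d → ℕ := Pi.single i₀ h with hδdef
  have hδi : δ i₀ = h := by simp [hδdef]
  obtain ⟨b, hb, c, hc, hbc⟩ : ∃ b, b ≠ P p ∧ ∃ c, c ≠ P p ∧ b ≠ c := by
    have h1 : 1 < (Finset.univ.erase (P p)).card := by
      rw [Finset.card_erase_of_mem (Finset.mem_univ _), Finset.card_univ]
      omega
    obtain ⟨b, hb, c, hc, hbc⟩ := Finset.one_lt_card.1 h1
    exact ⟨b, Finset.ne_of_mem_erase hb, c, Finset.ne_of_mem_erase hc, hbc⟩
  obtain ⟨x₁, r, hr, hrb⟩ := hN p hp b hb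
  obtain ⟨x₂, r', hr', hrc⟩ := hN p hp c hc
  have key : ∀ {x' s : Fin d → ℕ}, IsNearCopy k A P (x + p) x' s →
      (s i₀ + h < k → P (s + δ) = P p ∧ (s = z₁ ∨ s = z₂)) ∧
      (h ≤ s i₀ → ∃ u, u + δ = s ∧ P u = P p ∧ (u = z₁ ∨ u = z₂)) := by
    intro x' s hs
    have hsne : P p ≠ P s := by
      rw [← hA p hp]
      exact hs.2.2.1
    constructor
    · intro hsk
      have hin := lt_of_add_single_lt hs.1 hsk
      have hPs : P (s + δ) = P p :=
        (hs.apply_add hA hδ hin (lt_of_add_single_lt hp hpk)).trans hpadd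
      exact ⟨hPs, hM s hs.1 hin (by rw [hPs]; exact hsne.symm)⟩
    · intro hsh
      obtain ⟨u, hu, huk⟩ := exists_add_single_eq hs.1 hsh
      have hPu : P u = P p := (hs.apply_of_add_eq hA hδ hu hq huk hqk).trans hPq
      exact ⟨u, hu, hPu, hM u huk (by rw [hu]; exact hs.1) (by rw [hu, hPu]; exact hsne)⟩
  have hrp : P r ≠ P p := hrb ▸ hb
  have hrp' : P r' ≠ P p := hrc ▸ hc
  have hrr : P r ≠ P r' := by rwa [hrb, hrc]
  have main : ∀ {x' x'' s s' : Fin d → ℕ}, IsNearCopy k A P (x + p) x' s →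
      IsNearCopy k A P (x + p) x'' s' → P s ≠ P p → P s' ≠ P p → P s ≠ P s' →
      s i₀ < h ∨ k ≤ s i₀ + h := by
    intro x' x'' s s' hs hs' hsp hsp' hss
    by_contra! hcon
    obtain ⟨hPs, hsz⟩ := (key hs).1 hcon.2
    obtain ⟨u, hu, hPu, huz⟩ := (key hs).2 hcon.1
    have hsu : s ≠ u := by
      rintro rfl
      exact hsp hPu
    have hz : ∀ v : Fin d → ℕ, v = z₁ ∨ v = z₂ → v = s ∨ v = u := by
      intro v hv
      rcases hsz with rfl | rfl <;> rcases huz with rfl | rfl <;> tauto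
    rcases lt_or_ge (s' i₀ + h) k with hlt | hge
    · rcases hz s' ((key hs').1 hlt).2 with rfl | rfl
      · exact hss rfl
      · exact hsp' hPu
    · obtain ⟨v, hv, -, hvz⟩ := (key hs').2 (by omega)
      rcases hz v hvz with rfl | rfl
      · exact hsp' (hv ▸ hPs)
      · exact hss (by rw [← hu, hv])
  have hend : ∀ {x' s : Fin d → ℕ}, IsNearCopy k A P (x + p) x' s → s i₀ < h ∨ k ≤ s i₀ + h →
      ∃ z, (z = z₁ ∨ z = z₂) ∧ boundaryEnd i₀ h z = s := by
    intro x' s hs hor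
    rcases hor with hlt | hge
    · exact ⟨s, ((key hs).1 (by omega)).2, if_pos hlt⟩
    · obtain ⟨u, hu, -, huz⟩ := (key hs).2 (by omega)
      refine ⟨u, huz, ?_⟩
      have : u i₀ + h = s i₀ := by rw [← hu, Pi.add_apply, hδi]
      rw [boundaryEnd, if_neg (by omega), hu]
  obtain ⟨u, hu, hur⟩ := hend hr (main hr hr' hrp hrp' hrr)
  obtain ⟨v, hv, hvr⟩ := hend hr' (main hr' hr hrp' hrp hrr.symm)
  have hne : r ≠ r' := fun e => hrr (e ▸ rfl)
  rcases hu with rfl | rfl <;> rcases hv with rfl | rfl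
  · exact absurd (hur.symm.trans hvr) hne
  · exact ⟨⟨x₁, hur ▸ hr⟩, ⟨x₂, hvr ▸ hr'⟩, by rwa [hur, hvr]⟩
  · exact ⟨⟨x₂, hvr ▸ hr'⟩, ⟨x₁, hur ▸ hr⟩, by rw [hur, hvr]; exact hne.symm⟩
  · exact absurd (hur.symm.trans hvr) hne

/-- Near copies at two positions differing by `ε` with the same defect `r` determine the
`ε`-mismatches of `P`. -/
theorem IsNearCopy.apply_ne_apply_add_iff
    (hA : ∀ z : Fin d → ℕ, (∀ i, z i < k) → A (x + z) = P z)
    {p ε x₁ x₂ r : Fin d → ℕ} (hε : ε ≠ 0) (hp : ∀ i, p i < k) (hpε : ∀ i, (p + ε) i < k)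
    (h₁ : IsNearCopy k A P (x + p) x₁ r) (h₂ : IsNearCopy k A P (x + (p + ε)) x₂ r)
    {z : Fin d → ℕ} (hz : ∀ i, z i < k) (hzε : ∀ i, (z + ε) i < k) :
    P z ≠ P (z + ε) ↔ z = r ∨ z + ε = r := by
  have hx : x₂ = x₁ + ε := by
    have h := h₂.2.1
    rw [← add_assoc, ← h₁.2.1, add_right_comm] at h
    exact add_right_cancel h
  subst hx
  refine ⟨h₁.eq_or_eq_of_apply_ne h₂ hz hzε, ?_⟩
  rintro (rfl | hzr)
  · rw [h₁.apply_add hA hε hzε hpε, ← hA _ hpε]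
    exact h₂.2.2.1.symm
  · rw [hzr, h₂.apply_of_add_eq hA hε hzr rfl hz hp, ← hA _ hp]
    exact h₁.2.2.1

end Hubs

theorem eq_of_forall_unit_shift_iff {d k : ℕ} (hk : 3 ≤ k) (i₁ : Fin d) {r r' : Fin d → ℕ}
    (hr : ∀ i, r i < k) (hr' : ∀ i, r' i < k)
    (H : ∀ z : Fin d → ℕ, (∀ i, z i < k) → (∀ i, (z + Pi.single i₁ 1 : Fin d → ℕ) i < k) →
      ((z = r ∨ z + Pi.single i₁ 1 = r) ↔ (z = r' ∨ z + Pi.single i₁ 1 = r'))) :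
    r = r' := by
  set ε : Fin d → ℕ := Pi.single i₁ 1 with hε
  have hε1 : ∀ z : Fin d → ℕ, (z + ε) i₁ = z i₁ + 1 := fun z => by simp [hε]
  have up : ∀ s s' : Fin d → ℕ, (∀ i, s i < k) → (∀ i, s' i < k) → s + ε = s' →
      (∀ z : Fin d → ℕ, (∀ i, z i < k) → (∀ i, (z + ε) i < k) →
        ((z = s ∨ z + ε = s) ↔ (z = s' ∨ z + ε = s'))) → False := by
    rintro s _ hs hs' rfl Hs
    by_cases hlt : (s + ε) i₁ + 1 < k
    · rcases (Hs _ hs' (lt_of_add_single_lt hs' hlt)).2 (Or.inl rfl) with h | h <;>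
        have := congrFun h i₁ <;> simp only [hε1] at this <;> omega
    · have := hε1 s
      obtain ⟨q, hq, hqk⟩ := exists_add_single_eq (h := 1) (i₀ := i₁) hs (by omega)
      rw [← hε] at hq
      have hq1 := hε1 q
      rw [hq] at hq1
      rcases (Hs q hqk (by rw [hq]; exact hs)).1 (Or.inr hq) with h | h <;>
        have := congrFun h i₁ <;> simp only [hε1] at this <;> omega
  by_contra hne
  by_cases hlt : r i₁ + 1 < k
  · rcases (H r hr (lt_of_add_single_lt hr hlt)).1 (Or.inl rfl) with h | h
    · exact hne h
    · exact up r r' hr hr' h H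
  · obtain ⟨q, hq, hqk⟩ := exists_add_single_eq (h := 1) (i₀ := i₁) hr (by omega)
    rw [← hε] at hq
    rcases (H q hqk (by rw [hq]; exact hr)).1 (Or.inr hq) with h | h
    · exact up r' r hr' hr (h ▸ hq) fun z hz hz' => (H z hz hz').symm
    · exact hne (hq.symm.trans h)

/-- Any large enough pattern of dimension `d ≥ 2` over an alphabet of size at least 3
is removable. -/
theorem stmt2 (Γ : Type*) [Fintype Γ] [DecidableEq Γ] (hΓ : 3 ≤ Fintype.card Γ)
    (d k : ℕ) (hd : 2 ≤ d) (hk : 3 * 2 ^ d ≤ k)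
    (P : (Fin d → ℕ) → Γ) :
    Removable d k P := by
  intro n A x hcopy
  by_contra hno
  have hA : ∀ z : Fin d → ℕ, (∀ i, z i < k) → A (x + z) = P z := hcopy.2
  have hN : ∀ y : Fin d → ℕ, (∀ i, y i < k) → ∀ σ, σ ≠ P y →
      ∃ x' r, IsNearCopy k A P (x + y) x' r ∧ P r = σ := fun y hy σ hσ =>
    exists_isNearCopy hno hy (by rwa [hA y hy])
  have hk12 : 12 ≤ k := by
    have : 2 ^ 2 ≤ 2 ^ d := Nat.pow_le_pow_right (by norm_num) hd
    omega
  have hnear : ∀ y : Fin d → ℕ, ∃ x' r, (∀ i, y i < k) → IsNearCopy k A P (x + y) x' r := by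
    intro y
    by_cases hy : ∀ i, y i < k
    · have : Nontrivial Γ := Fintype.one_lt_card_iff_nontrivial.1 (by omega)
      obtain ⟨σ, hσ⟩ := exists_ne (P y)
      obtain ⟨x', r, h, -⟩ := hN y hy σ hσ
      exact ⟨x', r, fun _ => h⟩
    · exact ⟨0, 0, fun h => absurd h hy⟩
  choose f g hfg using hnear
  let i₀ : Fin d := ⟨0, by omega⟩
  let i₁ : Fin d := ⟨1, by omega⟩
  have hi : i₁ ≠ i₀ := by simp [i₀, i₁]
  obtain ⟨y, y', hy, hy', h, hpos, h3, hff⟩ := exists_offsets_differ_on_axis hd hk i₀ x f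
    (fun y hy i => by
      have h1 := congrFun (hfg y hy).2.1 i
      have h2 := (hfg y hy).1 i
      simp only [Pi.add_apply] at h1
      omega)
    (fun y y' hy hy' heq => by
      have h' := hfg y' hy'
      rw [← heq] at h'
      exact add_left_cancel ((hfg y hy).position_eq h'))
  have hM : ∀ z : Fin d → ℕ, (∀ i, z i < k) → (∀ i, (z + Pi.single i₀ h : Fin d → ℕ) i < k) →
      P z ≠ P (z + Pi.single i₀ h) → z = g y' ∨ z = g y - Pi.single i₀ h := by
    intro z hz hzδ hne
    have h' := hfg y' hy'
    rw [hff] at h'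
    refine ((hfg y hy).eq_or_eq_of_apply_ne h' hz hzδ hne).imp_right fun e => ?_
    rw [← e, add_tsub_cancel_right]
  obtain ⟨j, hj, hj1, hj2, hj3, hj4⟩ : ∃ j, j + 1 < k ∧ j ≠ g y' i₁ ∧
      j ≠ (g y - Pi.single i₀ h : Fin d → ℕ) i₁ ∧ j + 1 ≠ g y' i₁ ∧
      j + 1 ≠ (g y - Pi.single i₀ h : Fin d → ℕ) i₁ := by
    generalize g y' i₁ = a
    generalize (g y - Pi.single i₀ h : Fin d → ℕ) i₁ = b
    by_contra! hcon
    have e0 := hcon 0 (by omega)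
    have e2 := hcon 2 (by omega)
    have e4 := hcon 4 (by omega)
    omega
  have hubs : ∀ m : ℕ, m < k → m ≠ g y' i₁ → m ≠ (g y - Pi.single i₀ h : Fin d → ℕ) i₁ →
      (∀ i, (Pi.single i₀ h + Pi.single i₁ m : Fin d → ℕ) i < k) ∧
      (∃ x', IsNearCopy k A P (x + (Pi.single i₀ h + Pi.single i₁ m)) x'
        (boundaryEnd i₀ h (g y'))) ∧
      (∃ x', IsNearCopy k A P (x + (Pi.single i₀ h + Pi.single i₁ m)) x'
        (boundaryEnd i₀ h (g y - Pi.single i₀ h))) ∧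
      boundaryEnd i₀ h (g y') ≠ boundaryEnd i₀ h (g y - Pi.single i₀ h) := by
    intro m hmk hm1 hm2
    have hqk : ∀ i, (Pi.single i₁ m : Fin d → ℕ) i < k := by
      intro i
      by_cases hii : i = i₁
      · subst hii
        simpa using hmk
      · simp [hii]
        omega
    have hmatch : ∀ z : Fin d → ℕ, z i₁ = m → (∀ i, z i < k) →
        (∀ i, (z + Pi.single i₀ h : Fin d → ℕ) i < k) → P z = P (z + Pi.single i₀ h) := by
      intro z hzm hz hz'
      by_contra hne
      rcases hM z hz hz' hne with e | e
      · exact hm1 (hzm ▸ congrFun e i₁)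
      · exact hm2 (hzm ▸ congrFun e i₁)
    have hpk : ∀ i, (Pi.single i₁ m + Pi.single i₀ h : Fin d → ℕ) i < k :=
      lt_of_add_single_lt hqk (by simp [hi.symm]; omega)
    have hp0 : (Pi.single i₁ m + Pi.single i₀ h : Fin d → ℕ) i₀ + h < k := by
      simp [hi.symm]
      omega
    rw [add_comm (Pi.single i₀ h : Fin d → ℕ) (Pi.single i₁ m)]
    exact ⟨hpk, exists_isNearCopy_boundaryEnd hΓ hA hN hpos h3 hM hpk hp0 hqk rfl
      (hmatch _ (by simp [hi]) hpk (lt_of_add_single_lt hpk hp0)).symm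
      (hmatch _ (by simp) hqk hpk)⟩
  obtain ⟨hp, ⟨x₁, h₁⟩, ⟨x₂, h₂⟩, hne⟩ := hubs j (by omega) hj1 hj2
  obtain ⟨hp', ⟨x₃, h₁'⟩, ⟨x₄, h₂'⟩, -⟩ := hubs (j + 1) hj hj3 hj4
  rw [Pi.single_add, ← add_assoc (Pi.single i₀ h : Fin d → ℕ)] at hp' h₁' h₂'
  have hε : (Pi.single i₁ 1 : Fin d → ℕ) ≠ 0 := by simp
  exact hne (eq_of_forall_unit_shift_iff (by omega) i₁ h₁.1 h₂.1 fun z hz hz' =>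
    (h₁.apply_ne_apply_add_iff hA hε hp hp' h₁' hz hz').symm.trans
      (h₂.apply_ne_apply_add_iff hA hε hp hp' h₂' hz hz'))
end

section
/- Let P be a string (one-dimensional pattern) of length k ≥ 1 over {0,1} that is not almost homogeneous. Then P is removable over {0,1}. -/
/-- The string `S` of length `n` contains a copy of the pattern `P` of length `k`
at position `i`. -/
def HasCopy1 {Γ : Type*} (n k : ℕ) (S P : ℕ → Γ) (i : ℕ) : Prop :=
  i + k ≤ n ∧ ∀ j < k, S (i + j) = P j

/-- The pattern `P` of length `k` is removable over `Γ`. -/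
def Removable1 {Γ : Type*} [DecidableEq Γ] (k : ℕ) (P : ℕ → Γ) : Prop :=
  ∀ (n : ℕ) (S : ℕ → Γ) (i : ℕ), HasCopy1 n k S P i →
    ∃ (j : ℕ) (σ : Γ), j < k ∧ σ ≠ S (i + j) ∧
      ∀ i' : ℕ, HasCopy1 n k (Function.update S (i + j) σ) P i' → HasCopy1 n k S P i'

/-- The pattern `P` of length `k` is almost homogeneous: all its entries but one are
equal to some `a`, and the differing entry, of value `b ≠ a`, lies at an endpoint. -/
def AlmostHomogeneous1 {Γ : Type*} (k : ℕ) (P : ℕ → Γ) : Prop :=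
  ∃ (c : ℕ) (a b : Γ), (c = 0 ∨ c = k - 1) ∧ a ≠ b ∧ P c = b ∧
    ∀ j, j < k → j ≠ c → P j = a

/-- The window of length `k` of `S` starting at `x` agrees with `P` except precisely at the
entry `y` of `S`. -/
def NearCopyAt (k : ℕ) (S P : ℕ → Bool) (x y : ℕ) : Prop :=
  x ≤ y ∧ y < x + k ∧ S y ≠ P (y - x) ∧ ∀ t < k, x + t ≠ y → S (x + t) = P t

/-- A copy of `P` created by flipping the entry `y` is a near copy of `P` in `S`. -/
theorem nearCopyAt_of_hasCopy1_update {n k : ℕ} {S P : ℕ → Bool} {x y : ℕ}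
    (h : HasCopy1 n k (Function.update S y (!S y)) P x) (hS : ¬ HasCopy1 n k S P x) :
    NearCopyAt k S P x y := by
  obtain ⟨hn, h⟩ := h
  have off : ∀ t < k, x + t ≠ y → S (x + t) = P t := by
    intro t ht hne
    simpa [Function.update_of_ne hne] using h t ht
  have hxy : x ≤ y ∧ y < x + k := by
    by_contra hc
    exact hS ⟨hn, fun t ht => off t ht (by omega)⟩
  refine ⟨hxy.1, hxy.2, ?_, off⟩
  have := h (y - x) (by omega)
  rw [Nat.add_sub_cancel' hxy.1, Function.update_self] at this
  rw [← this]
  simp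

/-- If each single flip inside a copy of `P` at `i` creates a new copy, then two of the
windows involved are consecutive, so that `P` has at most two sign changes. -/
theorem exists_le_two_changes {k : ℕ} (hk : 1 ≤ k) {S P : ℕ → Bool} {i : ℕ}
    (h0 : ∀ t < k, S (i + t) = P t) {f : ℕ → ℕ}
    (hf : ∀ j < k, NearCopyAt k S P (f j) (i + j)) :
    ∃ p q, p ≤ q ∧ ∀ m, m + 1 < k → m ≠ p → m ≠ q → P m = P (m + 1) := by
  classical
  have hinj : ∀ a < k, ∀ b < k, f a = f b → a = b := by
    intro a ha b hb hab
    by_contra hne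
    obtain ⟨h1, h2, h3, -⟩ := hf a ha
    obtain ⟨-, -, -, h4⟩ := hf b hb
    apply h3
    have := h4 (i + a - f a) (by omega) (by omega)
    rwa [← hab, Nat.add_sub_cancel' h1] at this
  have hne : ∀ a < k, f a ≠ i := by
    intro a ha hi
    obtain ⟨-, -, h3, -⟩ := hf a ha
    apply h3
    rw [hi, Nat.add_sub_cancel_left]
    exact h0 a ha
  set A : Finset ℕ := insert i ((Finset.range k).image f) with hA
  have hcard : A.card = k + 1 := by
    rw [hA, Finset.card_insert_of_notMem, Finset.card_image_of_injOn, Finset.card_range]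
    · intro a ha b hb hab
      exact hinj a (by simpa using ha) b (by simpa using hb) hab
    · simp only [Finset.mem_image, Finset.mem_range, not_exists, not_and]
      exact hne
  have hmem : ∀ x ∈ A, i < x + k ∧ x < i + k ∧
      ∃ y, ∀ t < k, x + t ≠ y → S (x + t) = P t := by
    intro x hx
    rw [hA, Finset.mem_insert, Finset.mem_image] at hx
    rcases hx with rfl | ⟨a, ha, rfl⟩
    · exact ⟨by omega, by omega, 0, fun t ht _ => h0 t ht⟩
    · have ha := Finset.mem_range.1 ha
      obtain ⟨h1, h2, -, h4⟩ := hf a ha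
      refine ⟨?_, by omega, i + a, h4⟩
      omega
  obtain ⟨x, hx, hx'⟩ : ∃ x ∈ A, x + 1 ∈ A := by
    by_contra! hcon
    have hdis : Disjoint (A.image (· + k)) (A.image (· + (k + 1))) := by
      rw [Finset.disjoint_left]
      simp only [Finset.mem_image, not_exists, not_and]
      rintro _ ⟨x, hx, rfl⟩ y hy hxy
      exact hcon y hy ((by omega : y + 1 = x) ▸ hx)
    have hsub : A.image (· + k) ∪ A.image (· + (k + 1)) ⊆ Finset.Ioc i (i + 2 * k) := by
      intro z hz
      simp only [Finset.mem_union, Finset.mem_image] at hz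
      rw [Finset.mem_Ioc]
      rcases hz with ⟨x, hx, rfl⟩ | ⟨x, hx, rfl⟩ <;>
      · have := hmem x hx
        omega
    have := Finset.card_le_card hsub
    rw [Finset.card_union_of_disjoint hdis,
      Finset.card_image_of_injective _ (add_left_injective k),
      Finset.card_image_of_injective _ (add_left_injective (k + 1)), hcard, Nat.card_Ioc] at this
    omega
  obtain ⟨-, -, y, hy⟩ := hmem x hx
  obtain ⟨-, -, y', hy'⟩ := hmem _ hx'
  have key : ∀ m, m + 1 < k → m ≠ y - x - 1 → m ≠ y' - x - 1 → P m = P (m + 1) := by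
    intro m hm h1 h2
    rw [← hy (m + 1) hm (by omega), ← hy' m (by omega) (by omega)]
    congr 1
    omega
  rcases le_total (y - x - 1) (y' - x - 1) with h | h
  · exact ⟨_, _, h, key⟩
  · exact ⟨_, _, h, fun m hm h1 h2 => key m hm h2 h1⟩

/-- A sequence without changes on an interval is constant there. -/
theorem eq_of_forall_eq_succ {P : ℕ → Bool} {a b : ℕ}
    (h : ∀ m, a ≤ m → m < b → P m = P (m + 1)) : ∀ m, a ≤ m → m ≤ b → P m = P a := by
  intro m ham
  induction m, ham using Nat.le_induction with
  | base => intro _; rfl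
  | succ m ham ih =>
    intro hm
    rw [← h m ham (by omega), ih (by omega)]

/-- A pattern `α⋯αβ⋯β` with both blocks of length at least two: flipping its first entry
and flipping the last `α` cannot both create new copies. -/
theorem false_of_two_blocks {k i a x y : ℕ} {S P : ℕ → Bool} {α β : Bool} (hαβ : α ≠ β)
    (ha : 2 ≤ a) (hak : a + 2 ≤ k)
    (hα : ∀ m < a, P m = α) (hβ : ∀ m, a ≤ m → m < k → P m = β)
    (h0 : ∀ t < k, S (i + t) = P t)
    (hx : NearCopyAt k S P x i) (hy : NearCopyAt k S P y (i + (a - 1))) : False := by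
  obtain ⟨x1, x2, x3, x4⟩ := hx
  obtain ⟨y1, y2, y3, y4⟩ := hy
  rw [h0 _ (by omega), hα _ (by omega)] at y3
  have hi0 := h0 0 (by omega)
  rw [add_zero, hα 0 (by omega)] at hi0
  rw [hi0] at x3
  have hax : x + a ≤ i := by
    by_contra hc
    exact x3 (hα _ (by omega)).symm
  have hxk : x + (k - 1) = i := by
    by_contra hc
    have h1 := x4 (i - x + 1) (by omega) (by omega)
    rw [show x + (i - x + 1) = i + 1 by omega, h0 1 (by omega), hα 1 (by omega),
      hβ _ (by omega) (by omega)] at h1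
    exact hαβ h1
  have hprev := x4 (k - 2) (by omega) (by omega)
  rw [hβ (k - 2) (by omega) (by omega)] at hprev
  have hay : y < i := by
    by_contra hc
    exact y3 (hα _ (by omega)).symm
  by_cases hy1 : y + 1 = i
  · have h1 := y4 0 (by omega) (by omega)
    rw [hα 0 (by omega), show y + 0 = x + (k - 2) by omega, hprev] at h1
    exact hαβ h1.symm
  · have h1 := y4 (i + (a - 2) - y) (by omega) (by omega)
    rw [show y + (i + (a - 2) - y) = i + (a - 2) by omega, h0 _ (by omega),
      hα _ (by omega), hβ _ (by omega) (by omega)] at h1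
    exact hαβ h1

/-- A pattern `α⋯αβ⋯βα⋯α` whose first block is at least as long as its last one: flipping
the last entry creates no new copy. -/
theorem false_of_three_blocks_last {k i a b x : ℕ} {S P : ℕ → Bool} {α β : Bool} (hαβ : α ≠ β)
    (ha : 0 < a) (hab : a < b) (hbk : b < k) (hle : k ≤ a + b)
    (hα : ∀ m < a, P m = α) (hβ : ∀ m, a ≤ m → m < b → P m = β)
    (hγ : ∀ m, b ≤ m → m < k → P m = α)
    (h0 : ∀ t < k, S (i + t) = P t) (hne : x ≠ i)
    (hx : NearCopyAt k S P x (i + (k - 1))) : False := by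
  obtain ⟨x1, x2, x3, x4⟩ := hx
  rw [h0 _ (by omega), hγ _ (by omega) (by omega)] at x3
  obtain ⟨d, rfl⟩ : ∃ d, x = i + d := ⟨x - i, by omega⟩
  have hshift : ∀ t, t + d < k - 1 → P (d + t) = P t := by
    intro t ht
    rw [← x4 t (by omega) (by omega), ← h0 (d + t) (by omega), add_assoc]
  have h1 : a + d + 1 ≤ k := by
    by_contra hc
    exact x3 (hα _ (by omega)).symm
  have h2 : k ≤ b + d := by
    by_contra hc
    exact x3 (hγ _ (by omega) (by omega)).symm
  have h3 : b + 1 ≤ a + d := by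
    by_contra hc
    have := hshift (a - 1) (by omega)
    rw [hα (a - 1) (by omega), hβ _ (by omega) (by omega)] at this
    exact hαβ this.symm
  have h4 : a + d + 1 = k := by
    by_contra hc
    have := hshift a (by omega)
    rw [hγ _ (by omega) (by omega), hβ _ (by omega) (by omega)] at this
    exact hαβ this
  have := hshift (b - 1 - d) (by omega)
  rw [hα (b - 1 - d) (by omega), hβ _ (by omega) (by omega)] at this
  exact hαβ this.symm

/-- A pattern `α⋯αβ⋯βα⋯α` whose last block is at least as long as its first one: flipping
the first entry creates no new copy. -/
theorem false_of_three_blocks_first {k i a b x : ℕ} {S P : ℕ → Bool} {α β : Bool} (hαβ : α ≠ β)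
    (ha : 0 < a) (hab : a < b) (hle : a + b ≤ k)
    (hα : ∀ m < a, P m = α) (hβ : ∀ m, a ≤ m → m < b → P m = β)
    (hγ : ∀ m, b ≤ m → m < k → P m = α)
    (h0 : ∀ t < k, S (i + t) = P t) (hne : x ≠ i)
    (hx : NearCopyAt k S P x i) : False := by
  obtain ⟨x1, x2, x3, x4⟩ := hx
  have hi0 := h0 0 (by omega)
  rw [add_zero, hα 0 (by omega)] at hi0
  rw [hi0] at x3
  obtain ⟨e, rfl⟩ : ∃ e, i = x + e := ⟨i - x, by omega⟩
  rw [Nat.add_sub_cancel_left] at x3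
  have hshift : ∀ t, 0 < t → t + e < k → P t = P (t + e) := by
    intro t ht hte
    rw [← x4 (t + e) (by omega) (by omega), ← h0 t (by omega)]
    congr 1
    omega
  have h1 : a ≤ e := by
    by_contra hc
    exact x3 (hα _ (by omega)).symm
  have h2 : e < b := by
    by_contra hc
    exact x3 (hγ _ (by omega) (by omega)).symm
  have h3 : b < a + e := by
    by_contra hc
    have := hshift (b - e) (by omega) (by omega)
    rw [hβ _ (by omega) (by omega), hγ _ (by omega) (by omega)] at this
    exact hαβ this.symm
  have h4 : e + 1 = b := by
    by_contra hc
    have := hshift (b - 1 - e) (by omega) (by omega)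
    rw [hα _ (by omega), hβ _ (by omega) (by omega)] at this
    exact hαβ this
  have := hshift a ha (by omega)
  rw [hβ _ (by omega) (by omega), hγ _ (by omega) (by omega)] at this
  exact hαβ this.symm

/-- A pattern with at most one change which is not almost homogeneous: the flips inside a
copy of it cannot all create new copies. -/
theorem false_of_one_change {k i a : ℕ} {S P : ℕ → Bool} {α β : Bool}
    (hP : ¬ AlmostHomogeneous1 k P) (ha : a ≤ k)
    (hα : ∀ m < a, P m = α) (hβ : ∀ m, a ≤ m → m < k → P m = β) (hk : 1 ≤ k)
    (h0 : ∀ t < k, S (i + t) = P t) {f : ℕ → ℕ}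
    (hf : ∀ j < k, NearCopyAt k S P (f j) (i + j)) : False := by
  by_cases hconst : α = β ∨ a = 0 ∨ a = k
  · have hc : ∀ m < k, P m = P 0 := by
      intro m hm
      by_cases h1 : m < a <;> by_cases h2 : 0 < a
      · rw [hα m h1, hα 0 h2]
      · omega
      · rw [hβ m (by omega) hm, hα 0 h2]
        rcases hconst with h | h | h
        · exact h.symm
        all_goals omega
      · rw [hβ m (by omega) hm, hβ 0 (by omega) (by omega)]
    obtain ⟨h1, h2, h3, -⟩ := hf 0 (by omega)
    apply h3
    rw [h0 0 (by omega), hc (i + 0 - f 0) (by omega)]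
  push Not at hconst
  obtain ⟨hαβ, ha0, hak⟩ := hconst
  by_cases h1 : a = 1
  · exact hP ⟨0, β, α, Or.inl rfl, hαβ.symm, hα 0 (by omega),
      fun j hj hj0 => hβ j (by omega) hj⟩
  by_cases h2 : a + 1 = k
  · exact hP ⟨k - 1, α, β, Or.inr rfl, hαβ, hβ _ (by omega) (by omega),
      fun j hj hj0 => hα j (by omega)⟩
  exact false_of_two_blocks hαβ (by omega) (by omega) hα hβ h0 (hf 0 (by omega))
    (hf (a - 1) (by omega))

/-- A binary string pattern which is not almost homogeneous is removable. -/
theorem stmt3 (k : ℕ) (hk : 1 ≤ k) (P : ℕ → Bool)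
    (hP : ¬ AlmostHomogeneous1 k P) :
    Removable1 k P := by
  intro n S i hcopy
  have h0 := hcopy.2
  by_contra hcon
  have hex : ∀ j, ∃ x, j < k → NearCopyAt k S P x (i + j) := by
    intro j
    by_cases hj : j < k
    · by_contra! hx
      refine hcon ⟨j, !S (i + j), hj, by simp, fun x hc => ?_⟩
      by_contra hS
      exact (hx x).2 (nearCopyAt_of_hasCopy1_update hc hS)
    · exact ⟨0, fun h => absurd h hj⟩
  choose f hf using hex
  have hne : ∀ j < k, f j ≠ i := by
    intro j hj hi
    obtain ⟨-, -, h3, -⟩ := hf j hj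
    apply h3
    rw [hi, Nat.add_sub_cancel_left]
    exact h0 j hj
  obtain ⟨p, q, hpq, hch⟩ := exists_le_two_changes hk h0 hf
  have hα : ∀ m < k, m ≤ p → P m = P 0 := by
    intro m hm hmp
    exact eq_of_forall_eq_succ (b := m) (fun t _ ht => hch t (by omega) (by omega) (by omega))
      m (by omega) le_rfl
  have hβ : ∀ m < k, p < m → m ≤ q → P m = P (p + 1) := by
    intro m hm hpm hmq
    exact eq_of_forall_eq_succ (b := m) (fun t _ ht => hch t (by omega) (by omega) (by omega))
      m (by omega) le_rfl
  have hγ : ∀ m < k, q < m → P m = P (q + 1) := by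
    intro m hm hqm
    exact eq_of_forall_eq_succ (b := m) (fun t _ ht => hch t (by omega) (by omega) (by omega))
      m (by omega) le_rfl
  by_cases hdeg : k ≤ q + 1 ∨ p = q ∨ P (q + 1) = P (p + 1)
  · refine false_of_one_change (a := min (p + 1) k) (α := P 0) (β := P (p + 1)) hP
      (by omega) (fun m hm => hα m (by omega) (by omega)) ?_ hk h0 hf
    intro m hm hmk
    rcases le_or_gt m q with h | h
    · exact hβ m hmk (by omega) h
    · rw [hγ m hmk h]
      rcases hdeg with h | h | h
      · omega
      · rw [h]
      · exact h
  push Not at hdeg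
  obtain ⟨hqk, hpq', hne2⟩ := hdeg
  by_cases hne1 : P 0 = P (p + 1)
  · refine false_of_one_change (a := q + 1) (α := P 0) (β := P (q + 1)) hP
      (by omega) ?_ (fun m hm hmk => hγ m hmk (by omega)) hk h0 hf
    intro m hm
    rcases le_or_gt m p with h | h
    · exact hα m (by omega) h
    · rw [hβ m (by omega) h (by omega), hne1]
  have hαγ : P (q + 1) = P 0 := by
    revert hne1 hne2
    cases P 0 <;> cases P (p + 1) <;> cases P (q + 1) <;> simp
  have hα' : ∀ m < p + 1, P m = P 0 := fun m hm => hα m (by omega) (by omega)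
  have hβ' : ∀ m, p + 1 ≤ m → m < q + 1 → P m = P (p + 1) :=
    fun m h1 h2 => hβ m (by omega) (by omega) (by omega)
  have hγ' : ∀ m, q + 1 ≤ m → m < k → P m = P 0 :=
    fun m h1 h2 => (hγ m h2 (by omega)).trans hαγ
  rcases le_total k (p + 1 + (q + 1)) with h | h
  · exact false_of_three_blocks_last hne1 (by omega) (by omega) (by omega) h hα' hβ' hγ' h0
      (hne _ (by omega)) (hf (k - 1) (by omega))
  · exact false_of_three_blocks_first hne1 (by omega) (by omega) h hα' hβ' hγ' h0
      (hne 0 (by omega)) (hf 0 (by omega))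
end

section
/- Let Γ be a finite alphabet with |Γ| ≥ 3 and let P be a string (one-dimensional pattern) of length k ≥ 1 over Γ. Then P is removable over Γ. -/
/-- A copy that appears after a single change must cover the changed position. -/
theorem HasCopy1.mem_window_of_update {Γ : Type*} {n k m i : ℕ} {S P : ℕ → Γ} {σ : Γ}
    (h : HasCopy1 n k (Function.update S m σ) P i) (hS : ¬ HasCopy1 n k S P i) :
    i ≤ m ∧ m < i + k := by
  by_contra hm
  refine hS ⟨h.1, fun j hj => ?_⟩
  rw [← h.2 j hj, Function.update_of_ne (by omega)]

theorem HasCopy1.apply_sub {Γ : Type*} {n k m i : ℕ} {S P : ℕ → Γ}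
    (h : HasCopy1 n k S P i) (h₁ : i ≤ m) (h₂ : m < i + k) : S m = P (m - i) := by
  rw [← h.2 (m - i) (by omega), Nat.add_sub_cancel' h₁]

/-- Any string pattern over an alphabet of size at least 3 is removable. -/
theorem stmt4 (Γ : Type*) [Fintype Γ] [DecidableEq Γ] (hΓ : 3 ≤ Fintype.card Γ)
    (k : ℕ) (hk : 1 ≤ k) (P : ℕ → Γ) :
    Removable1 k P := by
  intro n S i hi
  by_contra! hcon
  choose! f hf hfS using hcon
  let A : Finset (Σ _ : ℕ, Γ) := (Finset.range k).sigma fun j => Finset.univ.erase (S (i + j))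
  let B : Finset ℕ := (Finset.Ioo i (i + 2 * k)).erase (i + k)
  have hA : ∀ a ∈ A, a.1 < k ∧ a.2 ≠ S (i + a.1) := by simp [A]
  have hwin : ∀ a ∈ A, f a.1 a.2 ≤ i + a.1 ∧ i + a.1 < f a.1 a.2 + k := fun a ha =>
    (hf _ _ (hA a ha).1 (hA a ha).2).mem_window_of_update (hfS _ _ (hA a ha).1 (hA a ha).2)
  have hval : ∀ a ∈ A, a.2 = P (i + a.1 - f a.1 a.2) := fun a ha => by
    simpa using (hf _ _ (hA a ha).1 (hA a ha).2).apply_sub (hwin a ha).1 (hwin a ha).2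
  have hmaps : ∀ a ∈ A, f a.1 a.2 + k ∈ B := fun a ha => by
    have hne : f a.1 a.2 ≠ i := fun h => hfS _ _ (hA a ha).1 (hA a ha).2 (h ▸ hi)
    have := hwin a ha
    have := (hA a ha).1
    simp only [B, Finset.mem_erase, Finset.mem_Ioo]
    omega
  have hinj : ∀ a ∈ A, ∀ b ∈ A, f a.1 a.2 + k = f b.1 b.2 + k → a = b := fun a ha b hb h => by
    have hab : f a.1 a.2 = f b.1 b.2 := by omega
    have hwa := hwin a ha
    have hva := hval a ha
    have hfst : a.1 = b.1 := by
      by_contra hne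
      have hb' := (hf _ _ (hA b hb).1 (hA b hb).2).apply_sub (hab ▸ hwa.1) (hab ▸ hwa.2)
      rw [Function.update_of_ne (by omega), ← hab, ← hva] at hb'
      exact (hA a ha).2 hb'.symm
    have hsnd : a.2 = b.2 := by rw [hva, hval b hb, hab, hfst]
    exact Sigma.ext hfst (heq_of_eq hsnd)
  have hle : A.card ≤ B.card :=
    Finset.card_le_card_of_injOn (fun a => f a.1 a.2 + k) hmaps fun a ha b hb => hinj a ha b hb
  have hAcard : A.card = k * (Fintype.card Γ - 1) := by
    simp [A, Finset.card_sigma, Finset.card_erase_of_mem]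
  have hBcard : B.card = 2 * k - 1 - 1 := by
    rw [Finset.card_erase_of_mem (by simp only [Finset.mem_Ioo]; omega), Nat.card_Ioo]
    omega
  have hmul : k * 2 ≤ k * (Fintype.card Γ - 1) := Nat.mul_le_mul_left k (by omega)
  omega
end

section
/- Let P be a d-dimensional pattern of side length k over an alphabet Γ and suppose some letter σ ∈ Γ does not appear among the values of P (i.e., P_y ≠ σ for all y ∈ [k]^d). Then P is removable over Γ. -/
/-- If some letter `σ` of the alphabet does not appear among the values of the
pattern `P`, then `P` is removable. -/
theorem stmt5 (Γ : Type*) [DecidableEq Γ] (d k : ℕ) (hk : 1 ≤ k)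
    (P : (Fin d → ℕ) → Γ) (σ : Γ)
    (hσ : ∀ y : Fin d → ℕ, (∀ i, y i < k) → P y ≠ σ) :
    Removable d k P := by
  intro n A x hx
  refine ⟨fun _ => 0, σ, fun _ => hk, ?_, ?_⟩
  · rw [hx.2 (fun _ => 0) fun _ => hk]
    exact (hσ _ fun _ => hk).symm
  · intro x' hx'
    refine ⟨hx'.1, fun y hy => ?_⟩
    have h := hx'.2 y hy
    rw [Function.update_apply] at h
    split_ifs at h
    · exact absurd h.symm (hσ y hy)
    · exact h
end

section
/- Let P be a d-dimensional pattern of side length k over {0,1} and let A be a binary d-dimensional array containing a copy of P starting at position p. Let a, b ∈ [k]^d, let A^{(a)} (resp. A^{(b)}) be the array obtained from A by flipping the entry at p+a (resp. p+b), and suppose A^{(a)} contains a copy of P starting at q_a and A^{(b)} contains a copy of P starting at q_b, where (q_a, q_b) is an (i,Δ)-related pair for some i ∈ {1,…,d} and integer Δ > 0. Then for every (i,Δ)-related pair (x,y) of points of [k]^d with y ≠ (p+a) − q_a and x ≠ (p+b) − q_b, it holds that P_x = P_y. -/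
/-- The pair of points `(x, y)` is `(i, δ)`-related: `y i - x i = δ` and `y j = x j`
for every `j ≠ i`. -/
def Related (d : ℕ) (i : Fin d) (δ : ℕ) (x y : Fin d → ℕ) : Prop :=
  y i = x i + δ ∧ ∀ j, j ≠ i → y j = x j

/-- If flipping the template entries at `a` resp. `b` creates `P`-copies at `q_a`
resp. `q_b`, where `(q_a, q_b)` is an `(i, Δ)`-related pair, then every
`(i, Δ)`-related pair `(x, y)` of points of `[k]^d` with `y ≠ (p + a) - q_a` and
`x ≠ (p + b) - q_b` satisfies `P x = P y`.  (The conditions `y ≠ (p + a) - q_a` and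
`x ≠ (p + b) - q_b` are expressed as `q_a + y ≠ p + a` and `q_b + x ≠ p + b`.) -/
theorem stmt7 (d n k : ℕ) (P A : (Fin d → ℕ) → Bool) (p a b qa qb : Fin d → ℕ)
    (hcopy : HasCopy d n k A P p)
    (ha : ∀ i, a i < k) (hb : ∀ i, b i < k)
    (i : Fin d) (Δ : ℕ) (hΔ : 0 < Δ)
    (hQa : HasCopy d n k
      (Function.update A (fun j => p j + a j) (!(A (fun j => p j + a j)))) P qa)
    (hQb : HasCopy d n k
      (Function.update A (fun j => p j + b j) (!(A (fun j => p j + b j)))) P qb)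
    (hrel : Related d i Δ qa qb) :
    ∀ x y : Fin d → ℕ, (∀ j, x j < k) → (∀ j, y j < k) → Related d i Δ x y →
      (fun j => qa j + y j) ≠ (fun j => p j + a j) →
      (fun j => qb j + x j) ≠ (fun j => p j + b j) →
      P x = P y := by
  intro x y hx hy hxy hya hxb
  have hQx := hQb.2 x hx
  have hQy := hQa.2 y hy
  rw [Function.update_of_ne hxb] at hQx
  rw [Function.update_of_ne hya] at hQy
  rw [← hQx, ← hQy]
  congr 1
  funext j
  by_cases hj : j = i
  · subst hj
    have := hrel.1
    have := hxy.1
    omega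
  · rw [hrel.2 j hj, hxy.2 j hj]
end

section
/- Let d ≥ 2, let P be a d-dimensional pattern of side length k over {0,1}, and let Δ = (Δ_1,…,Δ_d) be a vector of integers with 0 < Δ_i < k/3 for every i. Suppose that for each i ∈ {1,…,d} there are at most two (i,Δ_i)-related pairs of points of [k]^d that are (i,Δ_i)-jumps in P. Then no two (Δ,P)-isolated points of [k]^d are Δ-neighbours. -/
/-- `y` is a `Δ`-neighbour of `x`: for some direction `i`, either `(x, y)` or `(y, x)`
is `(i, Δᵢ)`-related. -/
def IsNeighbour (d : ℕ) (Δ : Fin d → ℕ) (x y : Fin d → ℕ) : Prop :=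
  ∃ i : Fin d, Related d i (Δ i) x y ∨ Related d i (Δ i) y x

/-- `x` is `(Δ, P)`-isolated: `P x ≠ P y` for every `Δ`-neighbour `y ∈ [k]^d` of `x`. -/
def IsIsolated (d k : ℕ) (Δ : Fin d → ℕ) (P : (Fin d → ℕ) → Bool) (x : Fin d → ℕ) :
    Prop :=
  ∀ y : Fin d → ℕ, (∀ j, y j < k) → IsNeighbour d Δ x y → P x ≠ P y

/-- The `(i, δ)`-jumps in `P` whose endpoints lie in `[k]^d`. -/
def jumpPairs (d k : ℕ) (P : (Fin d → ℕ) → Bool) (i : Fin d) (δ : ℕ) :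
    Set ((Fin d → ℕ) × (Fin d → ℕ)) :=
  {pr | (∀ j, pr.1 j < k) ∧ (∀ j, pr.2 j < k) ∧ Related d i δ pr.1 pr.2 ∧ P pr.1 ≠ P pr.2}

theorem finite_jumpPairs (d k : ℕ) (P : (Fin d → ℕ) → Bool) (i : Fin d) (δ : ℕ) :
    (jumpPairs d k P i δ).Finite := by
  have hbox : {x : Fin d → ℕ | ∀ j, x j < k}.Finite :=
    (Set.finite_Iic fun _ : Fin d => k).subset fun x hx j => (hx j).le
  exact (hbox.prod hbox).subset fun pr h => ⟨h.1, h.2.1⟩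

/-- If the points of an `(i, Δᵢ)`-related pair are both isolated, there are more than two
`(i, Δᵢ)`-jumps: the pair itself, its prolongation by one step in direction `i`, and its
translate by one step in another direction. -/
theorem two_lt_ncard_jumpPairs_of_isIsolated {d k : ℕ} (hd : 2 ≤ d)
    {P : (Fin d → ℕ) → Bool} {Δ : Fin d → ℕ} (hΔpos : ∀ i, 0 < Δ i)
    (hΔk : ∀ i, 3 * Δ i < k) {i : Fin d} {x y : Fin d → ℕ} (hx : ∀ j, x j < k)
    (hy : ∀ j, y j < k) (hxP : IsIsolated d k Δ P x) (hyP : IsIsolated d k Δ P y)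
    (h : Related d i (Δ i) x y) : 2 < (jumpPairs d k P i (Δ i)).ncard := by
  have : Nontrivial (Fin d) := Fin.nontrivial_iff_two_le.2 hd
  obtain ⟨j, hji⟩ := exists_ne i
  have hxy : P x ≠ P y := hxP y hy ⟨i, Or.inl h⟩
  have bound {z : Fin d → ℕ} (hz : ∀ l, z l < k) (m : Fin d) {v : ℕ} (hv : v < k) (l : Fin d) :
      Function.update z m v l < k := by
    rw [Function.update_apply]; split_ifs <;> [exact hv; exact hz l]
  obtain ⟨p, hp, hpi, hpj⟩ :
      ∃ p ∈ jumpPairs d k P i (Δ i), p.1 i ≠ x i ∧ p.1 j = x j := by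
    have hpos := hΔpos i
    have hk := hΔk i
    have hxi := hx i
    have hyi := h.1
    by_cases hlt : y i + Δ i < k
    · have hb := bound hy i hlt
      have hr : Related d i (Δ i) y (Function.update y i (y i + Δ i)) :=
        ⟨by simp, fun l hl => by simp [hl]⟩
      exact ⟨(y, _), ⟨hy, hb, hr, hyP _ hb ⟨i, Or.inl hr⟩⟩, by dsimp only; omega, h.2 j hji⟩
    · have hb := bound hx i (show x i - Δ i < k by omega)
      have hr : Related d i (Δ i) (Function.update x i (x i - Δ i)) x :=
        ⟨by rw [Function.update_self]; omega, fun l hl => by simp [hl]⟩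
      exact ⟨(Function.update x i (x i - Δ i), x), ⟨hb, hx, hr, (hxP _ hb ⟨i, Or.inr hr⟩).symm⟩,
        by simp only [Function.update_self]; omega, Function.update_of_ne hji _ _⟩
  obtain ⟨v, hvk, hvx, hv⟩ :
      ∃ v < k, v ≠ x j ∧ (v = x j + Δ j ∨ x j = v + Δ j) := by
    have hpos := hΔpos j
    have hk := hΔk j
    have hxj := hx j
    by_cases hlt : x j + Δ j < k
    · exact ⟨x j + Δ j, hlt, by omega, Or.inl rfl⟩
    · exact ⟨x j - Δ j, by omega, by omega, by omega⟩
  have neighbour {z : Fin d → ℕ} (hz : z j = x j) :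
      IsNeighbour d Δ z (Function.update z j v) := by
    refine ⟨j, hv.imp (fun hv => ⟨?_, fun l hl => ?_⟩) (fun hv => ⟨?_, fun l hl => ?_⟩)⟩ <;>
      simp [*]
  have hxP' := hxP _ (bound hx j hvk) (neighbour rfl)
  have hyP' := hyP _ (bound hy j hvk) (neighbour (h.2 j hji))
  have hq : (Function.update x j v, Function.update y j v) ∈ jumpPairs d k P i (Δ i) := by
    refine ⟨bound hx j hvk, bound hy j hvk, ⟨by simpa [hji.symm] using h.1, fun l hl => ?_⟩, ?_⟩
    · simp only [Function.update_apply, h.2 l hl]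
    · dsimp only
      rw [Bool.eq_not.2 hxP'.symm, Bool.eq_not.2 hyP'.symm]
      simpa using hxy
  refine (Set.two_lt_ncard_iff (finite_jumpPairs d k P i (Δ i))).2
    ⟨(x, y), p, _, ⟨hx, hy, h, hxy⟩, hp, hq, ?_, ?_, ?_⟩
  · rintro rfl
    exact hpi rfl
  · intro he
    have := congrFun (congrArg Prod.fst he) j
    simp only [Function.update_self] at this
    exact hvx this.symm
  · rintro rfl
    exact hvx (by simpa using hpj)

/-- If for each `i` at most two `(i, Δᵢ)`-related pairs of points of `[k]^d` are
`(i, Δᵢ)`-jumps in `P`, where `0 < Δᵢ < k/3`, then no two `(Δ, P)`-isolated points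
of `[k]^d` are `Δ`-neighbours. -/
theorem stmt8 (d k : ℕ) (hd : 2 ≤ d) (P : (Fin d → ℕ) → Bool)
    (Δ : Fin d → ℕ) (hΔpos : ∀ i, 0 < Δ i) (hΔk : ∀ i, 3 * Δ i < k)
    (hjumps : ∀ i : Fin d,
      Set.ncard {pr : (Fin d → ℕ) × (Fin d → ℕ) |
        (∀ j, pr.1 j < k) ∧ (∀ j, pr.2 j < k) ∧
        Related d i (Δ i) pr.1 pr.2 ∧ P pr.1 ≠ P pr.2} ≤ 2) :
    ∀ x y : Fin d → ℕ, (∀ j, x j < k) → (∀ j, y j < k) →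
      IsIsolated d k Δ P x → IsIsolated d k Δ P y → ¬ IsNeighbour d Δ x y := by
  rintro x y hx hy hxP hyP ⟨i, h | h⟩
  · exact (hjumps i).not_gt (two_lt_ncard_jumpPairs_of_isIsolated hd hΔpos hΔk hx hy hxP hyP h)
  · exact (hjumps i).not_gt (two_lt_ncard_jumpPairs_of_isIsolated hd hΔpos hΔk hy hx hyP hxP h)
end

section
/- Let P be a d-dimensional pattern of side length k over an alphabet Γ that is removable over Γ, and let A be a d-dimensional array of side length n over Γ. Then h_P(A) ≤ d_P(A) ≤ (4^d + 2^d)·h_P(A), and if n ≥ k then h_P(A) ≤ ⌊n/k⌋^d. -/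
/-- The array `A` of side length `n` is `P`-free. -/
def PFree {Γ : Type*} (d n k : ℕ) (A P : (Fin d → ℕ) → Γ) : Prop :=
  ∀ x : Fin d → ℕ, ¬ HasCopy d n k A P x

/-- The deletion number `d_P(A)`: the minimum number of entries of `A` that must be
changed to obtain a `P`-free array. -/
noncomputable def delNum {Γ : Type*} (d n k : ℕ) (A P : (Fin d → ℕ) → Γ) : ℕ :=
  sInf {m : ℕ | ∃ A' : (Fin d → ℕ) → Γ,
    {x : Fin d → ℕ | (∀ i, x i < n) ∧ A' x ≠ A x}.ncard = m ∧ PFree d n k A' P}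

/-- The hitting number `h_P(A)`: the minimum size of a set `H ⊆ [n]^d` intersecting
every copy of `P` in `A`. -/
noncomputable def hitNum {Γ : Type*} (d n k : ℕ) (A P : (Fin d → ℕ) → Γ) : ℕ :=
  sInf {m : ℕ | ∃ H : Set (Fin d → ℕ), H ⊆ {x | ∀ i, x i < n} ∧ H.Finite ∧
    H.ncard = m ∧
    ∀ x : Fin d → ℕ, HasCopy d n k A P x →
      ∃ y : Fin d → ℕ, (∀ i, y i < k) ∧ (fun i => x i + y i) ∈ H}

theorem finite_box (d n : ℕ) : {x : Fin d → ℕ | ∀ i, x i < n}.Finite :=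
  Set.Finite.pi' fun _ => Set.finite_lt_nat n

/-- The set of entries of `[n]^d` at which two arrays differ. -/
def diffSet {Γ : Type*} (d n : ℕ) (A A' : (Fin d → ℕ) → Γ) : Set (Fin d → ℕ) :=
  {x | (∀ i, x i < n) ∧ A' x ≠ A x}

theorem finite_diffSet {Γ : Type*} (d n : ℕ) (A A' : (Fin d → ℕ) → Γ) :
    (diffSet d n A A').Finite :=
  (finite_box d n).subset fun _ hx => hx.1

theorem diffSet_self {Γ : Type*} (d n : ℕ) (A : (Fin d → ℕ) → Γ) :
    diffSet d n A A = ∅ := by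
  ext x; simp [diffSet]

theorem ncard_diffSet_triangle {Γ : Type*} (d n : ℕ) (A B C : (Fin d → ℕ) → Γ) :
    (diffSet d n A C).ncard ≤ (diffSet d n A B).ncard + (diffSet d n B C).ncard := by
  refine le_trans (Set.ncard_le_ncard ?_ ((finite_diffSet d n A B).union (finite_diffSet d n B C)))
    (Set.ncard_union_le _ _)
  rintro x ⟨hx, hne⟩
  by_cases h : B x = A x
  · exact Or.inr ⟨hx, h ▸ hne⟩
  · exact Or.inl ⟨hx, h⟩

theorem ncard_diffSet_update {Γ : Type*} (d n : ℕ) (A : (Fin d → ℕ) → Γ)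
    (p : Fin d → ℕ) (σ : Γ) :
    (diffSet d n A (Function.update A p σ)).ncard ≤ 1 := by
  rw [← Set.ncard_singleton p]
  refine Set.ncard_le_ncard ?_ (Set.finite_singleton p)
  rintro x ⟨-, hne⟩
  by_contra h
  exact hne (Function.update_of_ne h _ _)

/-- A copy at `x` determines the entry at every location it covers. -/
theorem HasCopy.apply_eq {Γ : Type*} {d n k : ℕ} {A P : (Fin d → ℕ) → Γ} {x : Fin d → ℕ}
    (h : HasCopy d n k A P x) (w y : Fin d → ℕ) (hy : ∀ i, y i < k)
    (hw : ∀ i, w i = x i + y i) : A w = P y := by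
  rw [← h.2 y hy]
  exact congrArg A (funext hw)

/-- Copies that do not cover a changed entry are not affected by the change. -/
theorem HasCopy.congr_array {Γ : Type*} {d n k : ℕ} {A B P : (Fin d → ℕ) → Γ} {x : Fin d → ℕ}
    (h : HasCopy d n k A P x)
    (hAB : ∀ y : Fin d → ℕ, (∀ i, y i < k) → B (fun i => x i + y i) = A (fun i => x i + y i)) :
    HasCopy d n k B P x :=
  ⟨h.1, fun y hy => (hAB y hy).trans (h.2 y hy)⟩

/-- Families of copies that can each be deleted by at most `c` changes, in any array and
without creating new copies, can be deleted one after the other. -/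
theorem exists_delete_family {Γ : Type*} {d n k : ℕ} {P : (Fin d → ℕ) → Γ} {ι : Type*}
    (T : ι → Set (Fin d → ℕ)) (c : ℕ) (I : Finset ι)
    (hT : ∀ j ∈ I, ∀ A : (Fin d → ℕ) → Γ, ∃ A' : (Fin d → ℕ) → Γ,
      (diffSet d n A A').ncard ≤ c ∧
      ∀ x, HasCopy d n k A' P x → HasCopy d n k A P x ∧ x ∉ T j)
    (A : (Fin d → ℕ) → Γ) :
    ∃ A' : (Fin d → ℕ) → Γ, (diffSet d n A A').ncard ≤ I.card * c ∧
      ∀ x, HasCopy d n k A' P x → HasCopy d n k A P x ∧ ∀ j ∈ I, x ∉ T j := by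
  classical
  induction I using Finset.induction_on with
  | empty => exact ⟨A, by simp [diffSet_self], fun x hx => ⟨hx, by simp⟩⟩
  | insert a I ha ih =>
    obtain ⟨B, hB, hBcopy⟩ := ih fun j hj => hT j (Finset.mem_insert_of_mem hj)
    obtain ⟨C, hC, hCcopy⟩ := hT a (Finset.mem_insert_self a I) B
    refine ⟨C, ?_, fun x hx => ?_⟩
    · rw [Finset.card_insert_of_notMem ha, Nat.succ_mul]
      exact (ncard_diffSet_triangle d n A B C).trans (add_le_add hB hC)
    · obtain ⟨h1, h2⟩ := hCcopy x hx
      obtain ⟨h3, h4⟩ := hBcopy x h1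
      refine ⟨h3, fun j hj => ?_⟩
      rcases Finset.mem_insert.1 hj with rfl | hj
      · exact h2
      · exact h4 j hj

theorem Removable.exists_delete_singleton {Γ : Type*} [DecidableEq Γ] {d k : ℕ}
    {P : (Fin d → ℕ) → Γ} (hrem : Removable d k P) (n : ℕ) (A : (Fin d → ℕ) → Γ)
    (x : Fin d → ℕ) :
    ∃ A' : (Fin d → ℕ) → Γ, (diffSet d n A A').ncard ≤ 1 ∧
      ∀ x', HasCopy d n k A' P x' → HasCopy d n k A P x' ∧ x' ∉ ({x} : Set (Fin d → ℕ)) := by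
  by_cases hx : HasCopy d n k A P x
  · obtain ⟨y, σ, hy, hσ, hcopy⟩ := hrem n A x hx
    refine ⟨_, ncard_diffSet_update d n A (fun i => x i + y i) σ, fun x' hx' => ⟨hcopy x' hx', ?_⟩⟩
    rintro rfl
    have h1 := hx'.2 y hy
    rw [Function.update_self, ← hx.2 y hy] at h1
    exact hσ h1
  · refine ⟨A, by simp [diffSet_self], fun x' hx' => ⟨hx', ?_⟩⟩
    rintro rfl
    exact hx hx'

/-- After changing an entry in the middle of a copy, no two new copies have nearby
starting points. -/
theorem eq_of_new_copies {Γ : Type*} {d n k m : ℕ} {A P : (Fin d → ℕ) → Γ} (hm : 2 * m ≤ k + 1)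
    {x p : Fin d → ℕ} {σ : Γ} (hx : HasCopy d n k A P x) (hp : ∀ i, p i + 1 = x i + m)
    (hσ : σ ≠ A p) {t t' : Fin d → ℕ}
    (ht : HasCopy d n k (Function.update A p σ) P t)
    (ht' : HasCopy d n k (Function.update A p σ) P t')
    (htp : ∀ i, t i ≤ p i ∧ p i < t i + k)
    (hclose : ∀ i, t i < t' i + m ∧ t' i < t i + m) : t = t' := by
  by_contra hne
  have key : A (fun i => p i + t' i - t i) = A p := by
    have e1 := hx.apply_eq (fun i => p i + t' i - t i) (fun i => p i + t' i - t i - x i)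
      (fun i => by have := hp i; have := htp i; have := hclose i; omega)
      (fun i => by have := hp i; have := htp i; have := hclose i; omega)
    have e2 := hx.apply_eq p (fun i => p i - x i)
      (fun i => by have := hp i; have := htp i; have := hclose i; omega)
      (fun i => by have := hp i; have := htp i; have := hclose i; omega)
    have e3 := ht.apply_eq (fun i => t' i + (p i - x i)) (fun i => p i + t' i - t i - x i)
      (fun i => by have := hp i; have := htp i; have := hclose i; omega)
      (fun i => by have := hp i; have := htp i; have := hclose i; omega)
    have e4 := ht'.apply_eq (fun i => t' i + (p i - x i)) (fun i => p i - x i)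
      (fun i => by have := hp i; have := htp i; have := hclose i; omega)
      (fun i => rfl)
    rw [e1, e2, ← e3, ← e4]
  have hqp : (fun i => p i + t' i - t i) ≠ p := by
    intro h
    apply hne
    funext i
    have h1 := congrFun h i
    have h2 := htp i
    omega
  have f1 := ht.apply_eq p (fun i => p i - t i)
    (fun i => by have := htp i; omega) (fun i => by have := htp i; omega)
  have f2 := ht'.apply_eq (fun i => p i + t' i - t i) (fun i => p i - t i)
    (fun i => by have := htp i; omega) (fun i => by have := htp i; omega)
  rw [Function.update_self] at f1
  rw [Function.update_of_ne hqp, key, ← f1] at f2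
  exact hσ f2.symm

/-- All copies starting in a cube of side length `⌈k / 2⌉` can be deleted by `2 ^ d + 1`
changes. -/
theorem Removable.exists_delete_cluster {Γ : Type*} [DecidableEq Γ] {d k : ℕ}
    {P : (Fin d → ℕ) → Γ} (hrem : Removable d k P) (n : ℕ) (T : Set (Fin d → ℕ))
    (hT : ∀ x ∈ T, ∀ x' ∈ T, ∀ i, x i < x' i + (k + 1) / 2) (A : (Fin d → ℕ) → Γ) :
    ∃ A' : (Fin d → ℕ) → Γ, (diffSet d n A A').ncard ≤ 2 ^ d + 1 ∧
      ∀ x, HasCopy d n k A' P x → HasCopy d n k A P x ∧ x ∉ T := by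
  classical
  by_cases hex : ∃ x ∈ T, HasCopy d n k A P x
  swap
  · push Not at hex
    exact ⟨A, by simp [diffSet_self], fun x hx => ⟨hx, fun hxT => hex x hxT hx⟩⟩
  obtain ⟨x, hxT, hx⟩ := hex
  obtain ⟨y₀, σ₀, hy₀, hσ₀, -⟩ := hrem n A x hx
  obtain ⟨m, hm⟩ : ∃ m, m = (k + 1) / 2 := ⟨_, rfl⟩
  rw [← hm] at hT
  have hk : ∀ _ : Fin d, 0 < k := fun i => (Nat.zero_le _).trans_lt (hy₀ i)
  obtain ⟨p, hp⟩ : ∃ p : Fin d → ℕ, ∀ i, p i + 1 = x i + m :=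
    ⟨fun i => x i + (m - 1), fun i => by have := hk i; dsimp only; omega⟩
  obtain ⟨σ, hσ⟩ : ∃ σ : Γ, σ ≠ A p := by
    by_cases h : σ₀ = A p
    · exact ⟨_, fun h' => hσ₀ (h.trans h'.symm)⟩
    · exact ⟨σ₀, h⟩
  have cover : ∀ t, HasCopy d n k (Function.update A p σ) P t → ¬ HasCopy d n k A P t →
      ∀ i, t i ≤ p i ∧ p i < t i + k := by
    intro t ht hnt
    by_contra hcon
    refine hnt (ht.congr_array fun y hy => ?_)
    rw [Function.update_of_ne]
    rintro rfl
    exact hcon fun i => ⟨Nat.le_add_right _ _, Nat.add_lt_add_left (hy i) _⟩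
  have hnew : {t | HasCopy d n k (Function.update A p σ) P t ∧
      ¬ HasCopy d n k A P t}.Finite := by
    refine (finite_box d (n + 1)).subset fun t ht i => ?_
    have := ht.1.1 i
    omega
  have hcard : hnew.toFinset.card ≤ 2 ^ d := by
    have h := Finset.card_le_card_of_injOn (s := hnew.toFinset)
      (t := (Finset.univ : Finset (Fin d → Bool)))
      (fun t i => decide (p i < t i + m)) (fun _ _ => Finset.mem_coe.2 (Finset.mem_univ _)) ?_
    · simpa using h
    · intro t ht t' ht' heq
      simp only [Set.Finite.coe_toFinset, Set.mem_ofPred_eq] at ht ht'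
      refine eq_of_new_copies (m := m) (by omega) hx hp hσ ht.1 ht'.1 (cover t ht.1 ht.2)
        fun i => ?_
      have h1 := congrFun heq i
      have h2 := cover t ht.1 ht.2 i
      have h3 := cover t' ht'.1 ht'.2 i
      simp only [decide_eq_decide] at h1
      omega
  obtain ⟨B, hB, hBcopy⟩ := exists_delete_family (P := P) (n := n) (k := k)
    (fun t => ({t} : Set (Fin d → ℕ))) 1
    hnew.toFinset (fun t _ A => hrem.exists_delete_singleton n A t) (Function.update A p σ)
  refine ⟨B, ?_, fun z hz => ?_⟩
  · have h1 := ncard_diffSet_triangle d n A (Function.update A p σ) B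
    have h2 := ncard_diffSet_update d n A p σ
    omega
  · obtain ⟨h1, h2⟩ := hBcopy z hz
    have hzA : HasCopy d n k A P z := by
      by_contra h
      exact h2 z (hnew.mem_toFinset.2 ⟨h1, h⟩) rfl
    refine ⟨hzA, fun hzT => hσ ?_⟩
    have hlt : ∀ i, p i - z i < k ∧ p i = z i + (p i - z i) := fun i => by
      have := hp i
      have := hT z hzT x hxT i
      have := hT x hxT z hzT i
      omega
    have e1 := hzA.apply_eq p (fun i => p i - z i) (fun i => (hlt i).1) fun i => (hlt i).2
    have e2 := h1.apply_eq p (fun i => p i - z i) (fun i => (hlt i).1) fun i => (hlt i).2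
    rw [Function.update_self] at e2
    rw [e1, e2]

theorem Removable.exists_pFree_of_hitting {Γ : Type*} [DecidableEq Γ] {d k : ℕ}
    {P : (Fin d → ℕ) → Γ} (hrem : Removable d k P) (n : ℕ) (A : (Fin d → ℕ) → Γ)
    {H : Set (Fin d → ℕ)} (hfin : H.Finite)
    (hhit : ∀ x : Fin d → ℕ, HasCopy d n k A P x →
      ∃ y : Fin d → ℕ, (∀ i, y i < k) ∧ (fun i => x i + y i) ∈ H) :
    ∃ A' : (Fin d → ℕ) → Γ,
      (diffSet d n A A').ncard ≤ (4 ^ d + 2 ^ d) * H.ncard ∧ PFree d n k A' P := by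
  classical
  obtain ⟨B, hB, hBcopy⟩ := exists_delete_family (P := P) (n := n) (k := k)
    (fun j : (Fin d → ℕ) × (Fin d → Bool) =>
      {x | ∀ i, x i ≤ j.1 i ∧ j.1 i < x i + k ∧ (j.2 i = true ↔ j.1 i < x i + (k + 1) / 2)})
    (2 ^ d + 1) (hfin.toFinset ×ˢ Finset.univ)
    (fun j _ A => hrem.exists_delete_cluster n _ (fun x hx x' hx' i => by
      have h1 := hx i
      have h2 := hx' i
      have h3 := h1.2.2.symm.trans h2.2.2
      omega) A) A
  refine ⟨B, hB.trans_eq ?_, fun x hx => ?_⟩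
  · rw [Finset.card_product, Set.ncard_eq_toFinset_card H hfin]
    simp only [Finset.card_univ, Fintype.card_pi, Fintype.card_bool, Finset.prod_const,
      Fintype.card_fin]
    rw [show (4 : ℕ) = 2 * 2 from rfl, mul_pow]
    ring
  · obtain ⟨h1, h2⟩ := hBcopy x hx
    obtain ⟨y, hy, hyH⟩ := hhit x h1
    refine h2 (fun i => x i + y i, fun i => decide (x i + y i < x i + (k + 1) / 2))
      (by simpa using hyH) fun i => ⟨Nat.le_add_right _ _, Nat.add_lt_add_left (hy i) _, ?_⟩
    simp

theorem Removable.exists_hitting {Γ : Type*} [DecidableEq Γ] {d k : ℕ}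
    {P : (Fin d → ℕ) → Γ} (hrem : Removable d k P) (n : ℕ) (A : (Fin d → ℕ) → Γ) :
    ∃ H : Set (Fin d → ℕ), H ⊆ {x | ∀ i, x i < n} ∧ H.Finite ∧ H.ncard ≤ (n / k) ^ d ∧
      ∀ x : Fin d → ℕ, HasCopy d n k A P x →
        ∃ y : Fin d → ℕ, (∀ i, y i < k) ∧ (fun i => x i + y i) ∈ H := by
  refine ⟨Set.range fun (j : Fin d → Fin (n / k)) i => k * (j i : ℕ) + (k - 1), ?_,
    Set.finite_range _, ?_, fun x hx => ?_⟩
  · rintro _ ⟨j, rfl⟩ i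
    have h1 := (j i).2
    have hk : 0 < k := by
      rcases Nat.eq_zero_or_pos k with rfl | h
      · simp at h1
      · exact h
    have h2 : k * ((j i : ℕ) + 1) ≤ k * (n / k) := Nat.mul_le_mul_left k h1
    have h3 := Nat.mul_div_le n k
    rw [Nat.mul_succ] at h2
    dsimp only
    omega
  · rw [← Set.image_univ]
    refine (Set.ncard_image_le Set.finite_univ).trans ?_
    simp [Set.ncard_univ]
  · obtain ⟨y₀, -, hy₀, -⟩ := hrem n A x hx
    have hk : ∀ _ : Fin d, 0 < k := fun i => (Nat.zero_le _).trans_lt (hy₀ i)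
    have hlt : ∀ i, x i / k < n / k := fun i => by
      have h := Nat.div_le_div_right (c := k) (hx.1 i)
      rw [Nat.add_div_right _ (hk i)] at h
      exact h
    refine ⟨fun i => k * (x i / k) + (k - 1) - x i, fun i => ?_,
      fun i => ⟨x i / k, hlt i⟩, funext fun i => ?_⟩
    all_goals
      have h1 := Nat.div_add_mod (x i) k
      have h2 := Nat.mod_lt (x i) (hk i)
      dsimp only
      omega

theorem hitNum_le_ncard {Γ : Type*} {d n k : ℕ} {A P : (Fin d → ℕ) → Γ}
    {H : Set (Fin d → ℕ)} (hsub : H ⊆ {x | ∀ i, x i < n})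
    (hhit : ∀ x : Fin d → ℕ, HasCopy d n k A P x →
      ∃ y : Fin d → ℕ, (∀ i, y i < k) ∧ (fun i => x i + y i) ∈ H) :
    hitNum d n k A P ≤ H.ncard :=
  Nat.sInf_le ⟨H, hsub, (finite_box d n).subset hsub, rfl, hhit⟩

theorem delNum_le_ncard {Γ : Type*} {d n k : ℕ} {A A' P : (Fin d → ℕ) → Γ}
    (hfree : PFree d n k A' P) : delNum d n k A P ≤ (diffSet d n A A').ncard :=
  Nat.sInf_le ⟨A', rfl, hfree⟩

theorem hitNum_le_of_pFree {Γ : Type*} {d n k : ℕ} {A A' P : (Fin d → ℕ) → Γ}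
    (hfree : PFree d n k A' P) : hitNum d n k A P ≤ (diffSet d n A A').ncard := by
  refine hitNum_le_ncard (fun x hx => hx.1) fun x hx => ?_
  by_contra! hcon
  refine hfree x (hx.congr_array fun y hy => ?_)
  by_contra hne
  exact hcon y hy
    ⟨fun i => (Nat.add_lt_add_left (hy i) _).trans_le (hx.1 i), hne⟩

/-- For a removable pattern `P`: `h_P(A) ≤ d_P(A) ≤ (4^d + 2^d) · h_P(A)`, and if
`n ≥ k` then `h_P(A) ≤ ⌊n/k⌋^d`. -/
theorem stmt12 {Γ : Type*} [DecidableEq Γ] (d n k : ℕ)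
    (P A : (Fin d → ℕ) → Γ) (hrem : Removable d k P) :
    hitNum d n k A P ≤ delNum d n k A P ∧
    delNum d n k A P ≤ (4 ^ d + 2 ^ d) * hitNum d n k A P ∧
    (k ≤ n → hitNum d n k A P ≤ (n / k) ^ d) := by
  obtain ⟨G, hGsub, hGfin, hGcard, hGhit⟩ := hrem.exists_hitting n A
  refine ⟨?_, ?_, fun _ => (hitNum_le_ncard hGsub hGhit).trans hGcard⟩
  · obtain ⟨B, -, hB⟩ := hrem.exists_pFree_of_hitting n A hGfin hGhit
    obtain ⟨A', hA', hfree⟩ := Nat.sInf_mem (s := {m : ℕ | ∃ A' : (Fin d → ℕ) → Γ,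
      {x : Fin d → ℕ | (∀ i, x i < n) ∧ A' x ≠ A x}.ncard = m ∧ PFree d n k A' P})
      ⟨_, B, rfl, hB⟩
    exact (hitNum_le_of_pFree hfree).trans_eq hA'
  · obtain ⟨H, hsub, hfin, hcard, hhit⟩ := Nat.sInf_mem (s := {m : ℕ | ∃ H : Set (Fin d → ℕ),
      H ⊆ {x | ∀ i, x i < n} ∧ H.Finite ∧ H.ncard = m ∧
      ∀ x : Fin d → ℕ, HasCopy d n k A P x →
        ∃ y : Fin d → ℕ, (∀ i, y i < k) ∧ (fun i => x i + y i) ∈ H})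
      ⟨_, G, hGsub, hGfin, rfl, hGhit⟩
    obtain ⟨B, hBcard, hB⟩ := hrem.exists_pFree_of_hitting n A hfin hhit
    rw [hcard] at hBcard
    exact (delNum_le_ncard hB).trans hBcard
end

section
/- Let P be a d-dimensional pattern of side length k over an alphabet Γ and let A be a d-dimensional array of side length n over Γ. If S is a set of starting positions of copies of P in A that is 1/2-independent, then |S| ≤ 2^d · h_P(A). -/
/-- The hitting number is attained by some hitting set. -/
theorem exists_hitting_set {Γ : Type*} (d n k : ℕ) (hk : 1 ≤ k) (A P : (Fin d → ℕ) → Γ) :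
    ∃ H : Set (Fin d → ℕ), H.Finite ∧ H.ncard = hitNum d n k A P ∧
      ∀ x : Fin d → ℕ, HasCopy d n k A P x →
        ∃ y : Fin d → ℕ, (∀ i, y i < k) ∧ (fun i => x i + y i) ∈ H := by
  have hne : {m : ℕ | ∃ H : Set (Fin d → ℕ), H ⊆ {x | ∀ i, x i < n} ∧ H.Finite ∧
      H.ncard = m ∧ ∀ x : Fin d → ℕ, HasCopy d n k A P x →
        ∃ y : Fin d → ℕ, (∀ i, y i < k) ∧ (fun i => x i + y i) ∈ H}.Nonempty := by
    refine ⟨_, {x | ∀ i, x i < n}, subset_rfl, Set.Finite.pi' fun _ => Set.finite_lt_nat n, rfl,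
      fun x hx => ⟨fun _ => 0, fun _ => hk, fun i => ?_⟩⟩
    have := hx.1 i
    dsimp only
    omega
  obtain ⟨H, -, hfin, hcard, hhit⟩ := Nat.sInf_mem hne
  exact ⟨H, hfin, hcard, hhit⟩

/-- If `x + a = y + b` with `a, b` in the same half of `[k]`, then `x` and `y` are at distance
less than `k / 2`. -/
theorem two_mul_abs_sub_lt_of_add_eq_add {k x y a b : ℕ} (h : x + a = y + b) (ha : a < k)
    (hb : b < k) (hab : k ≤ 2 * a ↔ k ≤ 2 * b) : 2 * |(x : ℤ) - (y : ℤ)| < k := by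
  rcases abs_cases ((x : ℤ) - (y : ℤ)) with ⟨he, -⟩ | ⟨he, -⟩ <;> rw [he] <;> omega

/-- Any 1/2-independent set of starting positions of `P`-copies in `A` (i.e. any two
distinct positions `x, y` in it satisfy `|x i - y i| ≥ k/2` for some `i`) has size at
most `2^d · h_P(A)`. -/
theorem stmt13 {Γ : Type*} (d n k : ℕ) (hk : 1 ≤ k)
    (A P : (Fin d → ℕ) → Γ) (S : Set (Fin d → ℕ))
    (hcopies : ∀ x ∈ S, HasCopy d n k A P x)
    (hind : ∀ x ∈ S, ∀ y ∈ S, x ≠ y →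
      ∃ i : Fin d, (k : ℤ) ≤ 2 * |(x i : ℤ) - (y i : ℤ)|) :
    S.ncard ≤ 2 ^ d * hitNum d n k A P := by
  obtain ⟨H, hfin, hcard, hhit⟩ := exists_hitting_set d n k hk A P
  choose! f hf hfH using fun x hx => hhit x (hcopies x hx)
  let g : (Fin d → ℕ) → (Fin d → Bool) × (Fin d → ℕ) :=
    fun x => (fun i => decide (k ≤ 2 * f x i), fun i => x i + f x i)
  have hinj : Set.InjOn g S := by
    intro x hx y hy hxy
    by_contra hne
    obtain ⟨i, hi⟩ := hind x hx y hy hne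
    obtain ⟨hhalf, hsum⟩ := Prod.mk.inj hxy
    exact hi.not_gt (two_mul_abs_sub_lt_of_add_eq_add (congrFun hsum i) (hf x hx i) (hf y hy i)
      (decide_eq_decide.mp (congrFun hhalf i)))
  calc S.ncard ≤ (Set.univ ×ˢ H : Set ((Fin d → Bool) × (Fin d → ℕ))).ncard :=
        Set.ncard_le_ncard_of_injOn g (fun x hx => ⟨Set.mem_univ _, hfH x hx⟩) hinj
          (Set.finite_univ.prod hfin)
    _ = 2 ^ d * hitNum d n k A P := by simp [Set.ncard_prod, Set.ncard_univ, hcard]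
end

section
/- Let k, d ≥ 1 and let S ⊆ [n]^d be a set of points that is 1/2-independent (with respect to side length k). Then for every point z ∈ [n]^d, the number of x ∈ S with z ∈ x + [k]^d (i.e., 0 ≤ z_i − x_i < k for all i) is at most 2^d. -/
/-- If `S ⊆ [n]^d` is 1/2-independent with respect to side length `k` (any two
distinct points `x, y ∈ S` satisfy `|x i - y i| ≥ k/2` for some `i`), then every
point `z ∈ [n]^d` lies in the `k`-box `x + [k]^d` of at most `2^d` points `x ∈ S`. -/
theorem stmt14 (d n k : ℕ) (hd : 1 ≤ d) (hk : 1 ≤ k)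
    (S : Set (Fin d → ℕ)) (hS : S ⊆ {x | ∀ i, x i < n})
    (hind : ∀ x ∈ S, ∀ y ∈ S, x ≠ y →
      ∃ i : Fin d, (k : ℤ) ≤ 2 * |(x i : ℤ) - (y i : ℤ)|)
    (z : Fin d → ℕ) (hz : ∀ i, z i < n) :
    {x ∈ S | ∀ i, x i ≤ z i ∧ z i < x i + k}.ncard ≤ 2 ^ d := by
  have h := Set.ncard_le_ncard_of_injOn
    (s := {x ∈ S | ∀ i, x i ≤ z i ∧ z i < x i + k}) (t := Set.univ)
    (fun x (i : Fin d) => decide (2 * (z i - x i) < k)) (fun _ _ => Set.mem_univ _) ?_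
  · simpa [Set.ncard_univ, Nat.card_eq_fintype_card] using h
  · rintro x ⟨hxS, hx⟩ y ⟨hyS, hy⟩ hxy
    by_contra hne
    obtain ⟨i, hi⟩ := hind x hxS y hyS hne
    have hiff : 2 * (z i - x i) < k ↔ 2 * (z i - y i) < k := by
      simpa using congrFun hxy i
    have hxi := hx i
    have hyi := hy i
    rcases abs_cases ((x i : ℤ) - (y i : ℤ)) with h | h <;> omega
end

section
/- Let P be a d-dimensional pattern of side length k over {0,1} and let A be a binary d-dimensional array containing a copy of P starting at p. Let c = p + (⌊k/2⌋,…,⌊k/2⌋) and let A' be the array obtained from A by flipping the entry at c. Then the number of positions q such that A' contains a copy of P starting at q but A does not contain a copy of P starting at q is at most 2^d. -/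
/-- A copy which appears when the entry at `c` is changed covers `c`. -/
theorem exists_add_eq_of_hasCopy_update {Γ : Type*} {d n k : ℕ} {A P : (Fin d → ℕ) → Γ}
    {c q : Fin d → ℕ} {b : Γ} (h : HasCopy d n k (Function.update A c b) P q)
    (h' : ¬ HasCopy d n k A P q) :
    ∃ y : Fin d → ℕ, (∀ i, y i < k) ∧ (fun i => q i + y i) = c ∧ P y = b := by
  by_contra! hne
  refine h' ⟨h.1, fun y hy => ?_⟩
  have hcopy := h.2 y hy
  by_cases hc : (fun i => q i + y i) = c
  · rw [hc, Function.update_self] at hcopy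
    exact absurd hcopy.symm (hne y hy hc)
  · rwa [Function.update_of_ne hc] at hcopy

/-- After changing the central entry of a copy of `P`, two copies of `P` that cover this entry in
the same orthant coincide. -/
theorem HasCopy.eq_of_update_center {Γ : Type*} {d n k : ℕ} {A P : (Fin d → ℕ) → Γ}
    {p q q' y y' : Fin d → ℕ} {b : Γ} (hp : HasCopy d n k A P p)
    (hb : b ≠ A (fun i => p i + k / 2))
    (hq : HasCopy d n k (Function.update A (fun i => p i + k / 2) b) P q)
    (hq' : HasCopy d n k (Function.update A (fun i => p i + k / 2) b) P q')
    (hy : ∀ i, y i < k) (hy' : ∀ i, y' i < k)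
    (hqy : ∀ i, q i + y i = p i + k / 2) (hqy' : ∀ i, q' i + y' i = p i + k / 2)
    (hP' : P y' = b)
    (horth : ∀ i, y i < k / 2 ↔ y' i < k / 2) : q = q' := by
  by_contra hne
  have hm : ∀ i : Fin d, k / 2 < k := fun i => by have := hy i; omega
  let z : Fin d → ℕ := fun i => k / 2 + y' i - y i
  have hz : ∀ i, z i + y i = k / 2 + y' i ∧ z i < k := fun i => by
    have := hy i
    have := hy' i
    have := horth i
    simp only [z]
    omega
  have hzc : (fun i => p i + z i) ≠ fun i => p i + k / 2 := fun h => by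
    refine hne (funext fun i => ?_)
    have := congrFun h i
    have := hz i
    have := hqy i
    have := hqy' i
    omega
  have hpz : (fun i => p i + z i) = fun i => q i + y' i := funext fun i => by
    have := hz i
    have := hqy i
    omega
  have hqz : (fun i => q' i + z i) = fun i => q i + k / 2 := funext fun i => by
    have := hz i
    have := hqy i
    have := hqy' i
    omega
  have hPz : P z = b := by
    rw [← hp.2 z fun i => (hz i).2, ← Function.update_of_ne hzc b A, hpz, hq.2 y' hy', hP']
  have hPm : P z = P fun _ => k / 2 := by
    rw [← hq'.2 z fun i => (hz i).2, hqz, hq.2 (fun _ => k / 2) hm]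
  exact hb (by rw [← hPz, hPm, ← hp.2 (fun _ => k / 2) hm])

/-- Flipping the central bit `p + (⌊k/2⌋, …, ⌊k/2⌋)` of a `P`-copy starting at `p`
creates at most `2^d` new `P`-copies. -/
theorem stmt15 (d n k : ℕ) (P A : (Fin d → ℕ) → Bool) (p : Fin d → ℕ)
    (hp : HasCopy d n k A P p) :
    {q : Fin d → ℕ |
      HasCopy d n k
        (Function.update A (fun i => p i + k / 2)
          (!(A (fun i => p i + k / 2)))) P q ∧
      ¬ HasCopy d n k A P q}.ncard ≤ 2 ^ d := by
  have hcard : (Set.univ : Set (Fin d → Bool)).ncard = 2 ^ d := by simp [Set.ncard_univ]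
  rw [← hcard]
  refine Set.ncard_le_ncard_of_injOn (fun q i => decide (p i < q i))
    (fun _ _ => Set.mem_univ _) ?_ Set.finite_univ
  rintro q ⟨hq, hnq⟩ q' ⟨hq', hnq'⟩ heq
  obtain ⟨y, hy, hqy, -⟩ := exists_add_eq_of_hasCopy_update hq hnq
  obtain ⟨y', hy', hqy', hP'⟩ := exists_add_eq_of_hasCopy_update hq' hnq'
  refine hp.eq_of_update_center (by simp) hq hq' hy hy' (congrFun hqy) (congrFun hqy') hP'
    fun i => ?_
  have h : p i < q i ↔ p i < q' i := by simpa using congrFun heq i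
  have := congrFun hqy i
  have := congrFun hqy' i
  simp only at *
  omega
end
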